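/- arXiv:1611.09639 — 2 statements merged into one kernel-verified Lean document; each statement's English description precedes it below -/
import Mathlib

section
/- Let E be a finite-dimensional simple normed real algebra with n = dim_ℝ E. There exist constants C ≥ 1 and c > 0 depending only on E such that the following holds for every 0 < ρ ≤ 1/2. Let A ⊆ B(0, ρ^{-1}) be a subset of E that is ρ-away from subalgebras, and set A₁ = {1_E} ∪ A. Then for every η ∈ E with ρ ≤ ‖η‖ ≤ ρ^{-1}, the set A₁ⁿ · η · A₁ⁿ (the set of all products a_1⋯a_n η b_1⋯b_n with a_i, b_j ∈ A₁) contains a cρ^C-almost orthonormal basis of E. -/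
open Pointwise

section SeminormDefs

variable {E : Type*} [AddCommGroup E] [Module ℝ E]

/-- Closed ball of radius `r` around `x`, with respect to the (semi)norm `nm`. -/
def SBall (nm : Seminorm ℝ E) (x : E) (r : ℝ) : Set E := {y | nm (y - x) ≤ r}

/-- Distance from the point `a` to the set `W`, with respect to the (semi)norm `nm`. -/
noncomputable def SDist (nm : Seminorm ℝ E) (a : E) (W : Set E) : ℝ :=
  sInf ((fun w => nm (a - w)) '' W)

/-- Covering number of `S` at scale `δ`: the least number of closed `δ`-balls
(for the norm `nm`) needed to cover `S`. -/
noncomputable def SCov (nm : Seminorm ℝ E) (δ : ℝ) (S : Set E) : ℕ :=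
  sInf {N : ℕ | ∃ F : Finset E, F.card ≤ N ∧ S ⊆ ⋃ x ∈ F, SBall nm x δ}

end SeminormDefs

section AlgDefs

variable {E : Type*} [Ring E] [Algebra ℝ E]

/-- `A` is `ρ`-away from subalgebras: every proper unital subalgebra of `E` has a point of `A`
at distance at least `ρ` from it. -/
def AwayFromSubalgebras (nm : Seminorm ℝ E) (ρ : ℝ) (A : Set E) : Prop :=
  ∀ W : Subalgebra ℝ E, W ≠ ⊤ → ∃ a ∈ A, ρ ≤ SDist nm a (W : Set E)

/-- `GenSet A s` is the set `⟨A⟩_{s+1}` of the paper: `GenSet A 0 = A ∪ (-A) = ⟨A⟩₁` and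
`⟨A⟩_{s+1} = ⟨A⟩_s ∪ (⟨A⟩_s + ⟨A⟩₁) ∪ (⟨A⟩_s ⬝ ⟨A⟩₁)`. -/
def GenSet (A : Set E) : ℕ → Set E
  | 0 => A ∪ (-A)
  | (s + 1) => GenSet A s ∪ (GenSet A s + (A ∪ (-A))) ∪ (GenSet A s * (A ∪ (-A)))

end AlgDefs

/-- `ProdIter A k` is the set of products of exactly `k` elements of `A`
(with the empty product equal to `1`). -/
def ProdIter {E : Type*} [Monoid E] (A : Set E) : ℕ → Set E
  | 0 => {1}
  | (k + 1) => ProdIter A k * A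

/-- `(a_1, …, a_n)` is a `ρ`-almost orthonormal family for the (semi)norm `nm`:
every `a_k` has norm at most `ρ⁻¹` and is at distance at least `ρ` from the span of the
previous vectors. -/
def SAlmostONB {E : Type*} [AddCommGroup E] [Module ℝ E] (nm : Seminorm ℝ E) (ρ : ℝ)
    {n : ℕ} (a : Fin n → E) : Prop :=
  ∀ k : Fin n, nm (a k) ≤ ρ⁻¹ ∧
    ρ ≤ SDist nm (a k) (Submodule.span ℝ (a '' {j | j < k}) : Set E)



section ModerateNegligible

open Polynomial IntermediateField

set_option linter.unusedSectionVars false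

variable {K : Type*} [Field K] [LinearOrder K] [IsStrictOrderedRing K]

/-- `x` is bounded by a power of `ρ⁻¹`. -/
def IsModerate (ρ x : K) : Prop := ∃ m : ℕ, |x| * ρ ^ m ≤ 1

/-- `x` is bounded by every power of `ρ`. -/
def IsNegligible (ρ x : K) : Prop := ∀ m : ℕ, |x| ≤ ρ ^ m

variable {ρ : K}

lemma IsModerate.one : IsModerate ρ 1 := ⟨0, by simp⟩

lemma IsModerate.zero : IsModerate ρ 0 := ⟨0, by simp⟩

lemma IsModerate.neg {x : K} (hx : IsModerate ρ x) : IsModerate ρ (-x) := by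
  simpa [IsModerate] using hx

lemma IsModerate.mul (h0 : 0 < ρ) {x y : K} (hx : IsModerate ρ x) (hy : IsModerate ρ y) :
    IsModerate ρ (x * y) := by
  obtain ⟨m, hm⟩ := hx
  obtain ⟨k, hk⟩ := hy
  refine ⟨m + k, ?_⟩
  calc |x * y| * ρ ^ (m + k) = (|x| * ρ ^ m) * (|y| * ρ ^ k) := by rw [abs_mul]; ring
    _ ≤ 1 := mul_le_one₀ hm (by positivity) hk

lemma IsModerate.add (h0 : 0 < ρ) (h2 : ρ ≤ 1 / 2) {x y : K} (hx : IsModerate ρ x)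
    (hy : IsModerate ρ y) : IsModerate ρ (x + y) := by
  obtain ⟨m, hm⟩ := hx
  obtain ⟨k, hk⟩ := hy
  have h1 : ρ ≤ 1 := h2.trans (by norm_num)
  have hk1 : ρ ^ k ≤ 1 := pow_le_one₀ h0.le h1
  have hm1 : ρ ^ m ≤ 1 := pow_le_one₀ h0.le h1
  have hx' : |x| * ρ ^ m * ρ ^ k ≤ 1 := mul_le_one₀ hm (by positivity) hk1
  have hy' : |y| * ρ ^ k * ρ ^ m ≤ 1 := mul_le_one₀ hk (by positivity) hm1
  refine ⟨m + k + 1, ?_⟩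
  calc |x + y| * ρ ^ (m + k + 1) ≤ (|x| + |y|) * ρ ^ (m + k + 1) := by
        gcongr; exact abs_add_le x y
    _ = (|x| * ρ ^ m * ρ ^ k + |y| * ρ ^ k * ρ ^ m) * ρ := by ring
    _ ≤ (1 + 1) * (1 / 2) := by gcongr
    _ = 1 := by norm_num

lemma IsNegligible.isModerate {x : K} (hx : IsNegligible ρ x) : IsModerate ρ x :=
  ⟨0, by simpa using hx 0⟩

lemma IsNegligible.zero (h0 : 0 < ρ) : IsNegligible ρ 0 := fun m => by
  rw [abs_zero]; positivity

lemma IsNegligible.neg {x : K} (hx : IsNegligible ρ x) : IsNegligible ρ (-x) := by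
  simpa [IsNegligible] using hx

lemma IsNegligible.add (h0 : 0 < ρ) (h2 : ρ ≤ 1 / 2) {x y : K} (hx : IsNegligible ρ x)
    (hy : IsNegligible ρ y) : IsNegligible ρ (x + y) := fun m => by
  calc |x + y| ≤ |x| + |y| := abs_add_le x y
    _ ≤ ρ ^ (m + 1) + ρ ^ (m + 1) := add_le_add (hx _) (hy _)
    _ = 2 * ρ ^ m * ρ := by ring
    _ ≤ 2 * ρ ^ m * (1 / 2) := by gcongr
    _ = ρ ^ m := by ring

lemma IsNegligible.mul_left (h0 : 0 < ρ) {x y : K} (hx : IsModerate ρ x)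
    (hy : IsNegligible ρ y) : IsNegligible ρ (x * y) := fun k => by
  obtain ⟨m, hm⟩ := hx
  calc |x * y| = |x| * |y| := abs_mul x y
    _ ≤ |x| * ρ ^ (m + k) := by gcongr; exact hy _
    _ = |x| * ρ ^ m * ρ ^ k := by ring
    _ ≤ 1 * ρ ^ k := by gcongr
    _ = ρ ^ k := one_mul _

lemma not_isNegligible_one (h2 : ρ ≤ 1 / 2) : ¬ IsNegligible ρ 1 := fun h => by
  have := h 1
  rw [abs_one, pow_one] at this
  linarith

lemma IsModerate.inv_of_not_isNegligible (h0 : 0 < ρ) {x : K} (hx : ¬ IsNegligible ρ x) :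
    IsModerate ρ x⁻¹ := by
  simp only [IsNegligible, not_forall, not_le] at hx
  obtain ⟨m, hm⟩ := hx
  have hx0 : 0 < |x| := lt_trans (by positivity) hm
  refine ⟨m, ?_⟩
  rw [abs_inv, inv_mul_le_iff₀ hx0, mul_one]
  exact hm.le

lemma not_isNegligible_of_inv (h0 : 0 < ρ) (h2 : ρ ≤ 1 / 2) {x : K} (hx : x ≠ 0)
    (h : IsModerate ρ x⁻¹) : ¬ IsNegligible ρ x := fun hn =>
  not_isNegligible_one h2 (by simpa [hx] using hn.mul_left h0 h)

/-- The subring of moderate elements. -/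
def moderateSubring (h0 : 0 < ρ) (h2 : ρ ≤ 1 / 2) : Subring K where
  carrier := {x | IsModerate ρ x}
  mul_mem' := fun ha hb => ha.mul h0 hb
  one_mem' := .one
  add_mem' := fun ha hb => ha.add h0 h2 hb
  zero_mem' := .zero
  neg_mem' := fun ha => ha.neg

lemma isModerate_algebraMap [Algebra ℝ K] (h0 : 0 < ρ) (h2 : ρ ≤ 1 / 2) (r : ℝ) :
    IsModerate ρ (algebraMap ℝ K r) := by
  obtain ⟨m, hm⟩ := pow_unbounded_of_one_lt |r| (one_lt_two : (1 : ℝ) < 2)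
  have hmono : Monotone (algebraMap ℝ K) :=
    ringHom_monotone (fun r hr => ⟨√r, (Real.mul_self_sqrt hr).symm⟩) _
  have hle : |algebraMap ℝ K r| ≤ 2 ^ m := by
    rw [abs_le]
    have h1 := hmono (abs_le.1 hm.le).1
    have h3 := hmono (abs_le.1 hm.le).2
    simp only [map_neg, map_pow, map_ofNat] at h1 h3
    exact ⟨h1, h3⟩
  refine ⟨m, ?_⟩
  calc _ ≤ (2 : K) ^ m * (1 / 2) ^ m := by gcongr
    _ = 1 := by rw [← mul_pow]; norm_num

/-- A Hensel lemma for polynomials over an ordered field with the intermediate value property: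
a simple root modulo negligible elements is close to a root. -/
lemma exists_root_of_isNegligible (h0 : 0 < ρ) (h2 : ρ ≤ 1 / 2)
    (ivt : ∀ (q : K[X]) (a b : K), q.eval a * q.eval b ≤ 0 →
      ∃ y ∈ Set.uIcc a b, q.eval y = 0)
    (p : K[X]) (hp : ∀ i, IsModerate ρ (p.coeff i)) (x : K) (hx : IsModerate ρ x)
    (hpx : IsNegligible ρ (p.eval x)) (hdx : ¬ IsNegligible ρ (p.derivative.eval x)) :
    ∃ y, p.eval y = 0 ∧ IsNegligible ρ (x - y) := by
  set O := moderateSubring h0 h2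
  obtain ⟨P, rfl⟩ : ∃ P : O[X], P.map O.subtype = p := by
    rw [← Polynomial.mem_lifts, Polynomial.lifts_iff_coeff_lifts]
    exact fun i => ⟨⟨_, hp i⟩, rfl⟩
  set d := (P.map O.subtype).derivative.eval x
  set e := (P.map O.subtype).eval x
  have hd : IsModerate ρ d⁻¹ := .inv_of_not_isNegligible h0 hdx
  have hd0 : d ≠ 0 := fun h => hdx (h ▸ IsNegligible.zero h0)
  have h2d : IsModerate ρ (-2 * d⁻¹) := by
    rw [← one_add_one_eq_two]
    exact (IsModerate.one.add h0 h2 .one).neg.mul h0 hd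
  have hh : IsNegligible ρ (-2 * d⁻¹ * e) := hpx.mul_left h0 h2d
  obtain ⟨k, hk⟩ := P.binomExpansion ⟨x, hx⟩ ⟨_, hh.isModerate⟩
  have hk' : (P.map O.subtype).eval (x + -2 * d⁻¹ * e) =
      -e + (k * (-2 * d⁻¹) * (-2 * d⁻¹ * e)) * e := by
    have key := congrArg O.subtype hk
    rw [map_add, map_add, map_mul, map_mul, map_pow, ← Polynomial.eval_map_apply,
      ← Polynomial.eval_map_apply, ← Polynomial.eval_map_apply, ← Polynomial.derivative_map] at key
    change (P.map O.subtype).eval (x + -2 * d⁻¹ * e) =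
      e + d * (-2 * d⁻¹ * e) + k * (-2 * d⁻¹ * e) ^ 2 at key
    rw [key]
    field_simp
    ring
  have hsmall : |k * (-2 * d⁻¹) * (-2 * d⁻¹ * e)| ≤ 1 := by
    have hkm : IsModerate ρ (k : K) := k.2
    simpa using hh.mul_left h0 (hkm.mul h0 h2d) 0
  obtain ⟨y, hy, hy0⟩ := ivt (P.map O.subtype) x (x + -2 * d⁻¹ * e) (by
    rw [hk']
    nlinarith [(abs_le.1 hsmall).2, sq_nonneg e])
  refine ⟨y, hy0, fun m => ?_⟩
  refine le_trans ?_ (hh m)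
  have := Set.abs_sub_left_of_mem_uIcc hy
  rw [abs_sub_comm]
  simpa using this

/-- Every polynomial map `F[X]` evaluated at a moderate point takes moderate values, when `F`
consists of moderate elements. -/
lemma IsModerate.aeval [Algebra ℝ K] (h0 : 0 < ρ) (h2 : ρ ≤ 1 / 2)
    {F : IntermediateField ℝ K} (hF : ∀ f ∈ F, IsModerate ρ f) {x : K} (hx : IsModerate ρ x)
    (p : F[X]) : IsModerate ρ (p.aeval x) := by
  rw [Polynomial.aeval_eq_sum_range]
  refine (moderateSubring h0 h2).sum_mem fun i _ => ?_
  rw [Algebra.smul_def]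
  exact (moderateSubring h0 h2).mul_mem (hF _ (p.coeff i).2)
    ((moderateSubring h0 h2).pow_mem hx i)

/-- The ring of moderate elements contains a subfield representing all moderate elements modulo
negligible ones. -/
lemma exists_field_of_representatives [Algebra ℝ K] (h0 : 0 < ρ) (h2 : ρ ≤ 1 / 2)
    (ivt : ∀ (q : K[X]) (a b : K), q.eval a * q.eval b ≤ 0 →
      ∃ y ∈ Set.uIcc a b, q.eval y = 0) :
    ∃ F : IntermediateField ℝ K, (∀ f ∈ F, IsModerate ρ f) ∧
      ∀ x, IsModerate ρ x → ∃ f ∈ F, IsNegligible ρ (x - f) := by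
  obtain ⟨F, -, hF, hmax⟩ := zorn_le_nonempty₀
    {F : IntermediateField ℝ K | ∀ f ∈ F, IsModerate ρ f}
    (fun c hc hchain y hy => by
      have : Nonempty c := ⟨⟨y, hy⟩⟩
      refine ⟨⨆ i : c, i.1, fun f hf => ?_, fun z hz => le_iSup (fun i : c => i.1) ⟨z, hz⟩⟩
      rw [← SetLike.mem_coe, IntermediateField.coe_iSup_of_directed hchain.directed,
        Set.mem_iUnion] at hf
      obtain ⟨i, hi⟩ := hf
      exact hc i.2 f hi) ⊥ (fun f hf => by
      obtain ⟨r, rfl⟩ := IntermediateField.mem_bot.1 hf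
      exact isModerate_algebraMap h0 h2 r)
  have mem_of_adjoin : ∀ x : K, (∀ z ∈ F⟮x⟯, IsModerate ρ z) → x ∈ F := fun x hx => by
    have hle : F ≤ F⟮x⟯.restrictScalars ℝ := fun f hf => F⟮x⟯.algebraMap_mem ⟨f, hf⟩
    exact hmax (y := F⟮x⟯.restrictScalars ℝ) hx hle (mem_adjoin_simple_self F x)
  refine ⟨F, hF, fun x hx => ?_⟩
  by_cases htr : ∃ p : F[X], p ≠ 0 ∧ IsNegligible ρ (p.aeval x)
  · classical
    obtain ⟨p, ⟨hp0, hp⟩, hmin⟩ := exists_minimalFor_of_wellFoundedLT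
      (fun p : F[X] => p ≠ 0 ∧ IsNegligible ρ (p.aeval x)) natDegree htr
    have hdeg : p.natDegree ≠ 0 := fun hdeg => by
      obtain ⟨f, rfl⟩ := natDegree_eq_zero.1 hdeg
      rw [aeval_C] at hp
      have hf : (f : K) ≠ 0 := fun h => hp0 (by
        rw [(Subtype.ext h : f = 0), C_0])
      exact not_isNegligible_of_inv h0 h2 hf (hF _ (F.inv_mem f.2)) hp
    have hd : ¬ IsNegligible ρ (p.derivative.aeval x) := fun hd => by
      have hd0 : p.derivative ≠ 0 := fun h => hdeg (derivative_eq_zero.1 h)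
      have h1 := natDegree_derivative_lt hdeg
      exact absurd (hmin ⟨hd0, hd⟩ h1.le) (not_le.2 h1)
    rw [aeval_def, ← eval_map] at hp hd
    rw [← derivative_map] at hd
    obtain ⟨y, hy, hxy⟩ := exists_root_of_isNegligible h0 h2 ivt _
      (fun i => by rw [coeff_map]; exact hF _ (p.coeff i).2) x hx hp hd
    have hym : IsModerate ρ y := by
      simpa using hx.add h0 h2 hxy.isModerate.neg
    refine ⟨y, mem_of_adjoin y fun z hz => ?_, hxy⟩
    have halg : IsAlgebraic F y := ⟨p, hp0, by rw [aeval_def, ← eval_map, hy]⟩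
    rw [← mem_toSubalgebra, adjoin_simple_toSubalgebra_of_isAlgebraic halg,
      Algebra.adjoin_singleton_eq_range_aeval] at hz
    obtain ⟨q, rfl⟩ := hz
    exact hym.aeval h0 h2 hF q
  · push Not at htr
    refine ⟨x, mem_of_adjoin x fun z hz => ?_, by simpa using IsNegligible.zero h0⟩
    obtain ⟨r, s, rfl⟩ := (mem_adjoin_simple_iff F z).1 hz
    by_cases hs : s = 0
    · simpa [hs] using IsModerate.zero
    · rw [div_eq_mul_inv]
      exact (hx.aeval h0 h2 hF r).mul h0 (.inv_of_not_isNegligible h0 (htr s hs))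

end ModerateNegligible

section HyperrealVectors

open Filter Module Hyperreal
open scoped TensorProduct

namespace Hyperreal

noncomputable instance : Algebra ℝ Hyperreal := coeRingHom.toRingHom.toAlgebra

lemma algebraMap_eq_ofSeq (r : ℝ) : algebraMap ℝ Hyperreal r = ofSeq fun _ => r := rfl

lemma ofSeq_eq_ofSeq {f g : ℕ → ℝ} : ofSeq f = ofSeq g ↔ ∀ᶠ k in hyperfilter ℕ, f k = g k :=
  Germ.coe_eq

lemma ofSeq_add (f g : ℕ → ℝ) : ofSeq (fun k => f k + g k) = ofSeq f + ofSeq g := rfl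

lemma ofSeq_sub (f g : ℕ → ℝ) : ofSeq (fun k => f k - g k) = ofSeq f - ofSeq g := rfl

lemma ofSeq_mul (f g : ℕ → ℝ) : ofSeq (fun k => f k * g k) = ofSeq f * ofSeq g := rfl

lemma ofSeq_pow (f : ℕ → ℝ) (m : ℕ) : ofSeq (fun k => f k ^ m) = ofSeq f ^ m := rfl

lemma ofSeq_abs (f : ℕ → ℝ) : ofSeq (fun k => |f k|) = |ofSeq f| :=
  (Germ.abs_def (f : Germ (hyperfilter ℕ : Filter ℕ) ℝ)).symm

lemma ofSeq_one : ofSeq (fun _ => 1) = 1 := rfl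

lemma ofSeq_zero : ofSeq (fun _ => 0) = 0 := rfl

lemma ofSeq_sum {ι : Type*} (s : Finset ι) (f : ι → ℕ → ℝ) :
    ofSeq (fun k => ∑ i ∈ s, f i k) = ∑ i ∈ s, ofSeq (f i) := by
  classical
  induction s using Finset.induction_on with
  | empty => simp [ofSeq_zero]
  | insert a s ha ih => simp only [Finset.sum_insert ha, ofSeq_add, ih]

lemma isModerate_ofSeq {r f : ℕ → ℝ} :
    IsModerate (ofSeq r) (ofSeq f) ↔ ∃ m : ℕ, ∀ᶠ k in hyperfilter ℕ, |f k| * r k ^ m ≤ 1 := by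
  simp only [IsModerate, ← ofSeq_abs, ← ofSeq_pow, ← ofSeq_mul, ← ofSeq_one, ofSeq_le_ofSeq]

lemma isNegligible_ofSeq {r f : ℕ → ℝ} :
    IsNegligible (ofSeq r) (ofSeq f) ↔ ∀ m : ℕ, ∀ᶠ k in hyperfilter ℕ, |f k| ≤ r k ^ m := by
  simp only [IsNegligible, ← ofSeq_abs, ← ofSeq_pow, ofSeq_le_ofSeq]

open Polynomial in
lemma exists_eval_ofSeq (q : Hyperreal[X]) :
    ∃ Q : ℕ → ℝ[X], ∀ x : ℕ → ℝ, q.eval (ofSeq x) = ofSeq fun k => (Q k).eval (x k) := by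
  induction q using Polynomial.induction_on' with
  | add p q hp hq =>
    obtain ⟨P, hP⟩ := hp
    obtain ⟨Q, hQ⟩ := hq
    exact ⟨fun k => P k + Q k, fun x => by simp only [eval_add, hP, hQ, ofSeq_add]⟩
  | monomial m a =>
    obtain ⟨a, rfl⟩ := ofSeq_surjective a
    exact ⟨fun k => monomial m (a k), fun x => by
      simp only [eval_monomial, ofSeq_mul, ofSeq_pow]⟩

open Polynomial in
/-- The intermediate value property for polynomials over the hyperreals. -/
lemma exists_mem_uIcc_eval_eq_zero (q : Hyperreal[X]) (a b : Hyperreal)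
    (h : q.eval a * q.eval b ≤ 0) : ∃ y ∈ Set.uIcc a b, q.eval y = 0 := by
  obtain ⟨a, rfl⟩ := ofSeq_surjective a
  obtain ⟨b, rfl⟩ := ofSeq_surjective b
  obtain ⟨Q, hQ⟩ := exists_eval_ofSeq q
  rw [hQ, hQ, ← ofSeq_mul, ← ofSeq_zero, ofSeq_le_ofSeq] at h
  have key : ∀ k, ∃ y, (Q k).eval (a k) * (Q k).eval (b k) ≤ 0 →
      (min (a k) (b k) ≤ y ∧ y ≤ max (a k) (b k)) ∧ (Q k).eval y = 0 := fun k => by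
    by_cases hk : (Q k).eval (a k) * (Q k).eval (b k) ≤ 0
    · have h0 : (0 : ℝ) ∈ Set.uIcc ((Q k).eval (a k)) ((Q k).eval (b k)) := by
        rw [Set.mem_uIcc]
        rcases mul_nonpos_iff.1 hk with h | h
        · exact Or.inr h.symm
        · exact Or.inl h
      obtain ⟨y, hy, hy0⟩ := intermediate_value_uIcc (Q k).continuous.continuousOn h0
      exact ⟨y, fun _ => ⟨hy, hy0⟩⟩
    · exact ⟨0, fun h => absurd h hk⟩
  choose y hy using key
  refine ⟨ofSeq y, ?_, ?_⟩
  · have h1 : ofSeq (fun k => min (a k) (b k)) = min (ofSeq a) (ofSeq b) :=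
      (Germ.min_def (a : Germ (hyperfilter ℕ : Filter ℕ) ℝ)
        (b : Germ (hyperfilter ℕ : Filter ℕ) ℝ)).symm
    have h2 : ofSeq (fun k => max (a k) (b k)) = max (ofSeq a) (ofSeq b) :=
      (Germ.max_def (a : Germ (hyperfilter ℕ : Filter ℕ) ℝ)
        (b : Germ (hyperfilter ℕ : Filter ℕ) ℝ)).symm
    rw [Set.uIcc, Set.mem_Icc]
    rw [← h1, ← h2, ofSeq_le_ofSeq, ofSeq_le_ofSeq]
    exact ⟨h.mono fun k hk => (hy k hk).1.1, h.mono fun k hk => (hy k hk).1.2⟩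
  · rw [hQ, ← ofSeq_zero, ofSeq_eq_ofSeq]
    exact h.mono fun k hk => (hy k hk).2

end Hyperreal

variable {E : Type*} [Ring E] [Algebra ℝ E] {n : ℕ} (b : Basis (Fin n) ℝ E)

/-- The element of `ℝ* ⊗ E` represented by a sequence of elements of `E`. -/
noncomputable def hyperVec : (ℕ → E) →+ Hyperreal ⊗[ℝ] E where
  toFun x := ∑ i, ofSeq (fun k => b.repr (x k) i) ⊗ₜ b i
  map_zero' := by simp [ofSeq_zero]
  map_add' x y := by
    simp only [Pi.add_apply, map_add, Finsupp.add_apply, ofSeq_add, TensorProduct.add_tmul,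
      Finset.sum_add_distrib]

lemma hyperVec_repr (x : ℕ → E) (i : Fin n) :
    (Algebra.TensorProduct.basis Hyperreal b).repr (hyperVec b x) i =
      ofSeq fun k => b.repr (x k) i := by
  simp [hyperVec, Finsupp.single_apply, Finset.sum_apply']

lemma hyperVec_eq_iff {x y : ℕ → E} :
    hyperVec b x = hyperVec b y ↔ ∀ᶠ k in hyperfilter ℕ, x k = y k := by
  rw [(Algebra.TensorProduct.basis Hyperreal b).ext_elem_iff]
  simp only [hyperVec_repr, ofSeq_eq_ofSeq]
  rw [← eventually_all]
  simp only [b.ext_elem_iff]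

lemma hyperVec_surjective : Function.Surjective (hyperVec b) := fun z => by
  choose f hf using fun i =>
    ofSeq_surjective ((Algebra.TensorProduct.basis Hyperreal b).repr z i)
  refine ⟨fun k => ∑ i, f i k • b i, ?_⟩
  rw [(Algebra.TensorProduct.basis Hyperreal b).ext_elem_iff]
  intro i
  rw [hyperVec_repr, ← hf]
  simp [Finsupp.single_apply]

lemma hyperVec_smul_const (f : ℕ → ℝ) (e : E) :
    hyperVec b (fun k => f k • e) = ofSeq f ⊗ₜ e := by
  rw [(Algebra.TensorProduct.basis Hyperreal b).ext_elem_iff]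
  intro i
  rw [hyperVec_repr]
  simp [ofSeq_mul, algebraMap_eq_ofSeq]

lemma hyperVec_const (e : E) : hyperVec b (fun _ => e) = 1 ⊗ₜ e := by
  simpa [ofSeq_one] using hyperVec_smul_const b (fun _ => 1) e

lemma hyperVec_smul (f : ℕ → ℝ) (x : ℕ → E) :
    hyperVec b (fun k => f k • x k) = ofSeq f • hyperVec b x := by
  rw [(Algebra.TensorProduct.basis Hyperreal b).ext_elem_iff]
  intro i
  simp [hyperVec_repr, ofSeq_mul]

lemma hyperVec_eq_sum (x : ℕ → E) :
    x = ∑ i, fun k => b.repr (x k) i • b i := by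
  ext k
  simp [b.sum_repr]

lemma hyperVec_mul (x y : ℕ → E) : hyperVec b (x * y) = hyperVec b x * hyperVec b y := by
  conv_lhs => rw [hyperVec_eq_sum b x, hyperVec_eq_sum b y, Finset.sum_mul_sum]
  simp only [hyperVec, AddMonoidHom.coe_mk, ZeroHom.coe_mk, Finset.sum_mul_sum]
  change hyperVec b _ = _
  simp only [map_sum]
  refine Finset.sum_congr rfl fun i _ => Finset.sum_congr rfl fun j _ => ?_
  rw [Algebra.TensorProduct.tmul_mul_tmul, ← ofSeq_mul, ← hyperVec_smul_const]
  congr 1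
  ext k
  exact smul_mul_smul_comm _ _ _ _

end HyperrealVectors

section Algebraic

open Module

/-- In a finite-dimensional algebra, the products of exactly `n` elements of a generating set
containing `1` span the algebra, where `n` is the dimension. -/
lemma span_prodIter_eq_top {F T : Type*} [Field F] [Ring T] [Algebra F T] [FiniteDimensional F T]
    [Nontrivial T] (R : Set T) (h1 : (1 : T) ∈ R) (hR : Algebra.adjoin F R = ⊤) :
    Submodule.span F (ProdIter R (finrank F T)) = ⊤ := by
  have hsucc : ∀ k, Submodule.span F (ProdIter R (k + 1)) =
      Submodule.span F (ProdIter R k) * Submodule.span F R := fun k => by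
    rw [Submodule.span_mul_span]; rfl
  have hone : (1 : Submodule F T) ≤ Submodule.span F R :=
    Submodule.one_le.2 (Submodule.subset_span h1)
  have hle : ∀ k, Submodule.span F (ProdIter R k) ≤ Submodule.span F (ProdIter R (k + 1)) :=
    fun k => by
      rw [hsucc]
      exact le_mul_of_one_le_right' hone
  have hone_le : ∀ k, 1 ≤ Submodule.span F (ProdIter R k) := fun k => by
    induction k with
    | zero => exact Submodule.one_le.2 (Submodule.subset_span rfl)
    | succ k ih => exact ih.trans (hle k)
  have hstab : ∀ k, Submodule.span F (ProdIter R k) = Submodule.span F (ProdIter R (k + 1)) →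
      Submodule.span F (ProdIter R k) = ⊤ := fun k hk => by
    set S := Submodule.span F (ProdIter R k) with hS
    rw [hsucc, ← hS] at hk
    have hmul : ∀ x ∈ Algebra.adjoin F R, ∀ s ∈ S, s * x ∈ S := fun x hx => by
      induction hx using Algebra.adjoin_induction with
      | mem x hx =>
        intro s hs
        rw [hk]
        exact Submodule.mul_mem_mul hs (Submodule.subset_span hx)
      | algebraMap r =>
        intro s hs
        rw [← Algebra.commutes, ← Algebra.smul_def]
        exact S.smul_mem r hs
      | add x y _ _ hx hy =>
        intro s hs
        rw [mul_add]
        exact S.add_mem (hx s hs) (hy s hs)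
      | mul x y _ _ hx hy =>
        intro s hs
        rw [← mul_assoc]
        exact hy _ (hx s hs)
    rw [eq_top_iff]
    intro x _
    simpa using hmul x (hR ▸ trivial) 1 (Submodule.one_le.1 (hone_le k))
  have hdim : ∀ k, k + 1 ≤ finrank F (Submodule.span F (ProdIter R k)) ∨
      Submodule.span F (ProdIter R k) = ⊤ := fun k => by
    induction k with
    | zero =>
      left
      rw [zero_add, Nat.one_le_iff_ne_zero, Ne, Submodule.finrank_eq_zero]
      intro h
      have := Submodule.one_le.1 (hone_le 0)
      rw [h, Submodule.mem_bot] at this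
      exact one_ne_zero this
    | succ k ih =>
      by_cases hk : Submodule.span F (ProdIter R k) = ⊤
      · right
        exact top_le_iff.1 (hk ▸ hle k)
      · left
        have hlt := lt_of_le_of_ne (hle k) fun h => hk (hstab k h)
        have := Submodule.finrank_lt_finrank_of_lt hlt
        have := ih.resolve_right hk
        lia
  refine (hdim (finrank F T)).resolve_left fun h => ?_
  have := Submodule.finrank_le (Submodule.span F (ProdIter R (finrank F T)))
  lia

/-- In a simple algebra with basis `b`, every element is a combination of the `b i * y * b j`
as soon as `y ≠ 0`. -/
lemma exists_eq_sum_basis_mul_mul_basis {E : Type*} [Ring E] [Algebra ℝ E] [IsSimpleRing E]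
    {n : ℕ} (b : Basis (Fin n) ℝ E) {y : E} (hy : y ≠ 0) (x : E) :
    ∃ c : Fin n → Fin n → ℝ, x = ∑ i, ∑ j, c i j • (b i * y * b j) := by
  let S : Submodule ℝ E := Submodule.span ℝ {z | ∃ p q, z = p * y * q}
  have hl : ∀ p, ∀ s ∈ S, p * s ∈ S := fun p s hs => by
    induction hs using Submodule.span_induction with
    | mem s hs =>
      obtain ⟨u, v, rfl⟩ := hs
      exact Submodule.subset_span ⟨p * u, v, by simp only [mul_assoc]⟩
    | zero => simp
    | add s t _ _ hs ht => rw [mul_add]; exact S.add_mem hs ht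
    | smul r s _ hs => rw [mul_smul_comm]; exact S.smul_mem r hs
  have hr : ∀ q, ∀ s ∈ S, s * q ∈ S := fun q s hs => by
    induction hs using Submodule.span_induction with
    | mem s hs =>
      obtain ⟨u, v, rfl⟩ := hs
      exact Submodule.subset_span ⟨u, v * q, by simp only [mul_assoc]⟩
    | zero => simp
    | add s t _ _ hs ht => rw [add_mul]; exact S.add_mem hs ht
    | smul r s _ hs => rw [smul_mul_assoc]; exact S.smul_mem r hs
  let I : TwoSidedIdeal E := TwoSidedIdeal.mk' S S.zero_mem (fun hx hy => S.add_mem hx hy)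
    (fun hx => S.neg_mem hx) (fun hy => hl _ _ hy) (fun hx => hr _ _ hx)
  have hyI : y ∈ I := (TwoSidedIdeal.mem_mk' ..).2 (Submodule.subset_span ⟨1, 1, by simp⟩)
  have hI : I = ⊤ := (eq_bot_or_eq_top I).resolve_left fun h => hy (by
    rw [h] at hyI
    exact (TwoSidedIdeal.mem_bot E).1 hyI)
  have hxS : x ∈ S := (TwoSidedIdeal.mem_mk' ..).1 (show x ∈ I by rw [hI]; trivial)
  clear_value I
  induction hxS using Submodule.span_induction with
  | mem s hs =>
    obtain ⟨p, q, rfl⟩ := hs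
    refine ⟨fun i j => b.repr p i * b.repr q j, ?_⟩
    conv_lhs => rw [← b.sum_repr p, ← b.sum_repr q, Finset.sum_mul, Finset.sum_mul_sum]
    simp only [smul_mul_assoc, mul_smul_comm, smul_smul, mul_comm]
  | zero => exact ⟨0, by simp⟩
  | add s t _ _ hs ht =>
    obtain ⟨c, rfl⟩ := hs
    obtain ⟨d, rfl⟩ := ht
    exact ⟨c + d, by simp only [Pi.add_apply, add_smul, Finset.sum_add_distrib]⟩
  | smul r s _ hs =>
    obtain ⟨c, rfl⟩ := hs
    exact ⟨r • c, by simp only [Pi.smul_apply, smul_assoc, Finset.smul_sum]⟩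

end Algebraic

section NormEstimates

open Module

variable {E : Type*} [AddCommGroup E] [Module ℝ E]

lemma le_nm_of_le_sDist {nm : Seminorm ℝ E} {r : ℝ} {a : E} {W : Set E} (h : r ≤ SDist nm a W)
    {w : E} (hw : w ∈ W) : r ≤ nm (a - w) :=
  h.trans (csInf_le ⟨0, by rintro _ ⟨v, -, rfl⟩; exact apply_nonneg nm _⟩ ⟨w, hw, rfl⟩)

lemma nm_le_sum {n : ℕ} (nm : Seminorm ℝ E) (b : Basis (Fin n) ℝ E) (z : E) :
    nm z ≤ ∑ i, nm (b i) * |b.repr z i| := by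
  conv_lhs => rw [← b.sum_repr z]
  refine (Finset.le_sum_of_subadditive nm (map_zero nm).le (map_add_le_add nm) _ _).trans
    (Finset.sum_le_sum fun i _ => ?_)
  rw [map_smul_eq_mul, Real.norm_eq_abs, mul_comm]

lemma exists_abs_repr_le {n : ℕ} (nm : Seminorm ℝ E) (hnm : ∀ x : E, nm x = 0 → x = 0)
    (b : Basis (Fin n) ℝ E) : ∃ K : ℝ, 0 < K ∧ ∀ x i, |b.repr x i| ≤ K * nm x := by
  let _ : NormedAddCommGroup E := AddGroupNorm.toNormedAddCommGroup
    { nm with eq_zero_of_map_eq_zero' := hnm }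
  let _ : NormedSpace ℝ E := ⟨fun r x => (map_smul_eq_mul nm r x).le⟩
  have : FiniteDimensional ℝ E := b.finiteDimensional_of_finite
  let f : E →L[ℝ] (Fin n → ℝ) := LinearMap.toContinuousLinearMap b.equivFun.toLinearMap
  refine ⟨‖f‖ + 1, by positivity, fun x i => ?_⟩
  calc |b.repr x i| ≤ ‖f x‖ := norm_le_pi_norm (f x) i
    _ ≤ ‖f‖ * ‖x‖ := f.le_opNorm x
    _ ≤ (‖f‖ + 1) * ‖x‖ := by gcongr; linarith
    _ = _ := rfl

/-- Functionals approximately dual to a family `a` bound the coefficients of combinations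
of `a`. -/
lemma abs_coeff_le_of_approx_dual {n : ℕ} {nm : Seminorm ℝ E} {b : Basis (Fin n) ℝ E} {K : ℝ}
    (hK : ∀ x i, |b.repr x i| ≤ K * nm x) (a : Fin n → E) (N : Fin n → Fin n → ℝ)
    (hN : ∀ i l, |∑ j, N i j * b.repr (a l) j - if i = l then 1 else 0| ≤ 1 / (2 * n))
    (t : Fin n → ℝ) (l : Fin n) :
    |t l| ≤ 2 * K * (∑ i, ∑ j, |N i j|) * nm (∑ l, t l • a l) := by
  obtain ⟨i, -, hi⟩ := Finset.exists_max_image Finset.univ (fun i => |t i|) ⟨l, Finset.mem_univ l⟩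
  have hn : (0 : ℝ) < n := by exact_mod_cast Fin.pos l
  set z := ∑ l, t l • a l with hz
  have hexp : ∑ j, N i j * b.repr z j =
      t i + ∑ l, t l * (∑ j, N i j * b.repr (a l) j - if i = l then 1 else 0) := by
    have h1 : ∑ j, N i j * b.repr z j = ∑ l, t l * ∑ j, N i j * b.repr (a l) j := by
      simp only [hz, map_sum, map_smul, Finsupp.coe_finsetSum, Finset.sum_apply,
        Finsupp.smul_apply, smul_eq_mul, Finset.mul_sum]
      rw [Finset.sum_comm]
      exact Finset.sum_congr rfl fun _ _ => Finset.sum_congr rfl fun _ _ => by ring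
    simp [h1, mul_sub, Finset.sum_sub_distrib]
  have herr : |∑ l, t l * (∑ j, N i j * b.repr (a l) j - if i = l then 1 else 0)| ≤ |t i| / 2 := by
    calc _ ≤ ∑ l, |t l * (∑ j, N i j * b.repr (a l) j - if i = l then 1 else 0)| :=
          Finset.abs_sum_le_sum_abs _ _
      _ ≤ ∑ _l : Fin n, |t i| * (1 / (2 * n)) := by
          refine Finset.sum_le_sum fun l _ => ?_
          rw [abs_mul]
          exact mul_le_mul (hi l (Finset.mem_univ l)) (hN i l) (abs_nonneg _) (abs_nonneg _)
      _ = |t i| / 2 := by simp; field_simp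
  have hup : |∑ j, N i j * b.repr z j| ≤ K * (∑ i, ∑ j, |N i j|) * nm z := by
    calc _ ≤ ∑ j, |N i j * b.repr z j| := Finset.abs_sum_le_sum_abs _ _
      _ ≤ ∑ j, |N i j| * (K * nm z) := by
          refine Finset.sum_le_sum fun j _ => ?_
          rw [abs_mul]
          gcongr
          exact hK z j
      _ = (∑ j, |N i j|) * (K * nm z) := by rw [Finset.sum_mul]
      _ ≤ (∑ i, ∑ j, |N i j|) * (K * nm z) := by
          have hKz : 0 ≤ K * nm z := (abs_nonneg _).trans (hK z l)
          refine mul_le_mul_of_nonneg_right ?_ hKz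
          exact Finset.single_le_sum (f := fun i => ∑ j, |N i j|)
            (fun i _ => Finset.sum_nonneg fun j _ => abs_nonneg _) (Finset.mem_univ i)
      _ = _ := by ring
  have hlow : |t i| ≤ |∑ j, N i j * b.repr z j| + |t i| / 2 := by
    rw [hexp]
    have := abs_sub (t i + ∑ l, t l * (∑ j, N i j * b.repr (a l) j - if i = l then 1 else 0))
      (∑ l, t l * (∑ j, N i j * b.repr (a l) j - if i = l then 1 else 0))
    rw [add_sub_cancel_right] at this
    linarith
  have := hi l (Finset.mem_univ l)
  linarith

/-- A family whose coefficients are controlled by the norm of the combination, and whose vectors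
are bounded, is an almost orthonormal basis. -/
lemma sAlmostONB_of_coeff_le {n : ℕ} {nm : Seminorm ℝ E} {Q s : ℝ} (a : Fin n → E)
    (hQ : ∀ (t : Fin n → ℝ) (l : Fin n), |t l| ≤ Q * nm (∑ l, t l • a l)) (hs : 0 < s)
    (hQs : Q * s ≤ 1) (ha : ∀ l, nm (a l) * s ≤ 1) : SAlmostONB nm s a := by
  intro k
  refine ⟨by rw [← one_div, le_div_iff₀ hs]; exact ha k, ?_⟩
  refine le_csInf ⟨_, 0, Submodule.zero_mem _, rfl⟩ ?_
  rintro _ ⟨w, hw, rfl⟩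
  obtain ⟨c, hc, rfl⟩ : ∃ c : Fin n → ℝ, c k = 0 ∧ w = ∑ l, c l • a l := by
    induction hw using Submodule.span_induction with
    | mem w hw =>
      obtain ⟨j, hj, rfl⟩ := hw
      exact ⟨Pi.single j 1, by simp [(ne_of_lt hj : j ≠ k).symm], by simp [Pi.single_apply]⟩
    | zero => exact ⟨0, rfl, by simp⟩
    | add u v _ _ hu hv =>
      obtain ⟨c, hc, rfl⟩ := hu
      obtain ⟨d, hd, rfl⟩ := hv
      exact ⟨c + d, by simp [hc, hd], by simp [add_smul, Finset.sum_add_distrib]⟩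
    | smul r u _ hu =>
      obtain ⟨c, hc, rfl⟩ := hu
      exact ⟨r • c, by simp [hc], by simp [smul_smul, Finset.smul_sum]⟩
  have h := hQ (Pi.single k 1 - c) k
  have hsum : ∑ l, (Pi.single k 1 - c : Fin n → ℝ) l • a l = a k - ∑ l, c l • a l := by
    simp [sub_smul, Finset.sum_sub_distrib, Pi.single_apply]
  rw [hsum] at h
  simp only [Pi.sub_apply, Pi.single_eq_same, hc, sub_zero, abs_one] at h
  have hnn := apply_nonneg nm (a k - ∑ l, c l • a l)
  show s ≤ nm (a k - ∑ l, c l • a l)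
  nlinarith

lemma span_range_eq_top_of_coeff_le [FiniteDimensional ℝ E] {nm : Seminorm ℝ E} {Q : ℝ}
    (a : Fin (finrank ℝ E) → E)
    (hQ : ∀ (t : Fin (finrank ℝ E) → ℝ) l, |t l| ≤ Q * nm (∑ l, t l • a l)) :
    Submodule.span ℝ (Set.range a) = ⊤ := by
  refine LinearIndependent.span_eq_top_of_card_eq_finrank' ?_ (Fintype.card_fin _)
  rw [Fintype.linearIndependent_iff]
  intro t ht l
  have := hQ t l
  rw [ht, map_zero, mul_zero] at this
  exact abs_nonpos_iff.1 this

end NormEstimates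

section Reduction

open Module Filter Hyperreal
open scoped TensorProduct

lemma IsNegligible.sum {K ι : Type*} [Field K] [LinearOrder K] [IsStrictOrderedRing K] {ρ : K}
    (h0 : 0 < ρ) (h2 : ρ ≤ 1 / 2) (s : Finset ι) (f : ι → K)
    (h : ∀ i ∈ s, IsNegligible ρ (f i)) : IsNegligible ρ (∑ i ∈ s, f i) :=
  Finset.sum_induction f _ (fun _ _ ha hb => ha.add h0 h2 hb) (.zero h0) h

lemma IsModerate.sum {K ι : Type*} [Field K] [LinearOrder K] [IsStrictOrderedRing K] {ρ : K}
    (h0 : 0 < ρ) (h2 : ρ ≤ 1 / 2) (s : Finset ι) (f : ι → K)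
    (h : ∀ i ∈ s, IsModerate ρ (f i)) : IsModerate ρ (∑ i ∈ s, f i) :=
  (moderateSubring h0 h2).sum_mem h

variable {E : Type*} [Ring E] [Algebra ℝ E] {n : ℕ} (b : Basis (Fin n) ℝ E)

lemma tensor_repr_mul {K : Type*} [Field K] [Algebra ℝ K] (z w : K ⊗[ℝ] E) (l : Fin n) :
    (Algebra.TensorProduct.basis K b).repr (z * w) l =
      ∑ i, ∑ j, (Algebra.TensorProduct.basis K b).repr z i *
        (Algebra.TensorProduct.basis K b).repr w j * algebraMap ℝ K (b.repr (b i * b j) l) := by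
  set B := Algebra.TensorProduct.basis K b with hB
  conv_lhs => rw [← B.sum_repr z, ← B.sum_repr w, Finset.sum_mul_sum]
  simp only [map_sum, Finsupp.coe_finsetSum, Finset.sum_apply]
  refine Finset.sum_congr rfl fun i _ => Finset.sum_congr rfl fun j _ => ?_
  rw [smul_mul_smul_comm, map_smul, Finsupp.smul_apply, smul_eq_mul, hB,
    Algebra.TensorProduct.basis_apply, Algebra.TensorProduct.basis_apply,
    Algebra.TensorProduct.tmul_mul_tmul, Algebra.TensorProduct.basis_repr_tmul]
  simp

/-- All coordinates of a vector of `ℝ* ⊗ E` are moderate. -/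
def IsModerateVec (ρ : Hyperreal) (z : Hyperreal ⊗[ℝ] E) : Prop :=
  ∀ i, IsModerate ρ ((Algebra.TensorProduct.basis Hyperreal b).repr z i)

/-- All coordinates of a vector of `ℝ* ⊗ E` are negligible. -/
def IsNegligibleVec (ρ : Hyperreal) (z : Hyperreal ⊗[ℝ] E) : Prop :=
  ∀ i, IsNegligible ρ ((Algebra.TensorProduct.basis Hyperreal b).repr z i)

variable {b} {ρ : Hyperreal}

lemma IsNegligibleVec.add (h0 : 0 < ρ) (h2 : ρ ≤ 1 / 2) {z w : Hyperreal ⊗[ℝ] E}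
    (hz : IsNegligibleVec b ρ z) (hw : IsNegligibleVec b ρ w) : IsNegligibleVec b ρ (z + w) :=
  fun i => by
    rw [map_add]
    exact (hz i).add h0 h2 (hw i)

lemma IsNegligibleVec.mul_left (h0 : 0 < ρ) (h2 : ρ ≤ 1 / 2) {z w : Hyperreal ⊗[ℝ] E}
    (hz : IsModerateVec b ρ z) (hw : IsNegligibleVec b ρ w) : IsNegligibleVec b ρ (z * w) :=
  fun l => by
    rw [tensor_repr_mul]
    refine .sum h0 h2 _ _ fun i _ => .sum h0 h2 _ _ fun j _ => ?_
    rw [mul_right_comm]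
    exact (hw j).mul_left h0 ((hz i).mul h0 (isModerate_algebraMap h0 h2 _))

lemma IsNegligibleVec.mul_right (h0 : 0 < ρ) (h2 : ρ ≤ 1 / 2) {z w : Hyperreal ⊗[ℝ] E}
    (hz : IsNegligibleVec b ρ z) (hw : IsModerateVec b ρ w) : IsNegligibleVec b ρ (z * w) :=
  fun l => by
    rw [tensor_repr_mul]
    refine .sum h0 h2 _ _ fun i _ => .sum h0 h2 _ _ fun j _ => ?_
    rw [mul_assoc, mul_comm]
    exact (hz i).mul_left h0 ((hw j).mul h0 (isModerate_algebraMap h0 h2 _))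

variable (b ρ) {F : Type*} [Field F] [Algebra ℝ F] (φ : F →ₐ[ℝ] Hyperreal)

/-- The inclusion of `F ⊗ E` in `ℝ* ⊗ E`. -/
noncomputable def hyperIncl (E : Type*) [Ring E] [Algebra ℝ E] :
    F ⊗[ℝ] E →ₐ[ℝ] Hyperreal ⊗[ℝ] E :=
  Algebra.TensorProduct.map φ (AlgHom.id ℝ E)

lemma hyperIncl_smul (f : F) (t : F ⊗[ℝ] E) :
    hyperIncl φ E (f • t) = φ f • hyperIncl φ E t := by
  induction t with
  | zero => simp
  | add s t hs ht => simp [hs, ht]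
  | tmul g e => simp [hyperIncl, TensorProduct.smul_tmul']

lemma hyperIncl_repr (t : F ⊗[ℝ] E) (i : Fin n) :
    (Algebra.TensorProduct.basis Hyperreal b).repr (hyperIncl φ E t) i =
      φ ((Algebra.TensorProduct.basis F b).repr t i) := by
  conv_lhs => rw [← (Algebra.TensorProduct.basis F b).sum_repr t]
  simp only [map_sum, hyperIncl_smul, Algebra.TensorProduct.basis_apply]
  simp [hyperIncl, Finsupp.single_apply]

/-- The sequence `x` of elements of `E` represents `t : F ⊗ E` up to negligible errors. -/
def Represents (x : ℕ → E) (t : F ⊗[ℝ] E) : Prop :=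
  IsNegligibleVec b ρ (hyperVec b x - hyperIncl φ E t)

variable {b ρ φ}

lemma isModerateVec_hyperIncl (hF : ∀ f, IsModerate ρ (φ f)) (t : F ⊗[ℝ] E) :
    IsModerateVec b ρ (hyperIncl φ E t) := fun i => by
  rw [hyperIncl_repr]
  exact hF _

lemma Represents.isModerateVec (h0 : 0 < ρ) (h2 : ρ ≤ 1 / 2) (hF : ∀ f, IsModerate ρ (φ f))
    {x : ℕ → E} {t : F ⊗[ℝ] E} (h : Represents b ρ φ x t) : IsModerateVec b ρ (hyperVec b x) :=
  fun i => by
    have h1 := (h i).isModerate.add h0 h2 (isModerateVec_hyperIncl (b := b) hF t i)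
    rw [← Finsupp.add_apply, ← map_add, sub_add_cancel] at h1
    exact h1

lemma hyperIncl_one : hyperIncl φ E 1 = 1 := by
  rw [Algebra.TensorProduct.one_def, hyperIncl, Algebra.TensorProduct.map_tmul]
  simp [Algebra.TensorProduct.one_def]

lemma Represents.one (h0 : 0 < ρ) : Represents b ρ φ 1 1 := fun i => by
  have : hyperVec b 1 = 1 := hyperVec_const b 1
  rw [this, hyperIncl_one, sub_self, map_zero]
  exact .zero h0

lemma Represents.mul (h0 : 0 < ρ) (h2 : ρ ≤ 1 / 2) (hF : ∀ f, IsModerate ρ (φ f))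
    {x y : ℕ → E} {s t : F ⊗[ℝ] E} (hx : Represents b ρ φ x s) (hy : Represents b ρ φ y t) :
    Represents b ρ φ (x * y) (s * t) := by
  have h : hyperVec b (x * y) - hyperIncl φ E (s * t) =
      hyperVec b x * (hyperVec b y - hyperIncl φ E t) +
        (hyperVec b x - hyperIncl φ E s) * hyperIncl φ E t := by
    rw [hyperVec_mul, map_mul]
    noncomm_ring
  rw [Represents, h]
  exact (IsNegligibleVec.mul_left h0 h2 (hx.isModerateVec h0 h2 hF) hy).add h0 h2
    (IsNegligibleVec.mul_right h0 h2 hx (isModerateVec_hyperIncl hF t))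

lemma exists_represents (hFs : ∀ x, IsModerate ρ x → ∃ f, IsNegligible ρ (x - φ f)) {x : ℕ → E}
    (hx : IsModerateVec b ρ (hyperVec b x)) : ∃ t, Represents b ρ φ x t := by
  choose f hfx using fun i => hFs _ (hx i)
  refine ⟨∑ i, f i • Algebra.TensorProduct.basis F b i, fun i => ?_⟩
  rw [map_sub, Finsupp.sub_apply, hyperIncl_repr, Basis.repr_sum_self]
  exact hfx i

variable {r : ℕ → ℝ}

lemma isModerate_nm {nm : Seminorm ℝ E} (h0 : 0 < ofSeq r) (h2 : ofSeq r ≤ 1 / 2) {x : ℕ → E}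
    (hx : IsModerateVec b (ofSeq r) (hyperVec b x)) :
    ∃ m : ℕ, ∀ᶠ k in hyperfilter ℕ, nm (x k) * r k ^ m ≤ 1 := by
  have h : IsModerate (ofSeq r) (ofSeq fun k => ∑ i, nm (b i) * |b.repr (x k) i|) := by
    rw [ofSeq_sum]
    refine .sum h0 h2 _ _ fun i _ => ?_
    rw [ofSeq_mul, ofSeq_abs]
    refine (isModerate_algebraMap h0 h2 (nm (b i))).mul h0 ?_
    have := hx i
    rw [hyperVec_repr] at this
    simpa [IsModerate] using this
  obtain ⟨m, hm⟩ := isModerate_ofSeq.1 h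
  rw [← ofSeq_zero, ofSeq_lt_ofSeq] at h0
  refine ⟨m, ?_⟩
  filter_upwards [hm, h0] with k hk hk0
  refine le_trans ?_ hk
  gcongr
  exact (nm_le_sum nm b _).trans (le_abs_self _)

lemma isNegligible_nm {nm : Seminorm ℝ E} (h0 : 0 < ofSeq r) (h2 : ofSeq r ≤ 1 / 2) {x : ℕ → E}
    (hx : IsNegligibleVec b (ofSeq r) (hyperVec b x)) (m : ℕ) :
    ∀ᶠ k in hyperfilter ℕ, nm (x k) ≤ r k ^ m := by
  have h : IsNegligible (ofSeq r) (ofSeq fun k => ∑ i, nm (b i) * |b.repr (x k) i|) := by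
    rw [ofSeq_sum]
    refine .sum h0 h2 _ _ fun i _ => ?_
    rw [ofSeq_mul, ofSeq_abs]
    refine IsNegligible.mul_left h0 (isModerate_algebraMap h0 h2 (nm (b i))) ?_
    have := hx i
    rw [hyperVec_repr] at this
    simpa [IsNegligible] using this
  filter_upwards [isNegligible_ofSeq.1 h m] with k hk
  exact ((nm_le_sum nm b _).trans (le_abs_self _)).trans hk

lemma isModerateVec_of_nm_le {nm : Seminorm ℝ E} {K : ℝ}
    (hK : ∀ x i, |b.repr x i| ≤ K * nm x) (hr0 : ∀ k, 0 < r k) (h0 : 0 < ofSeq r)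
    (h2 : ofSeq r ≤ 1 / 2) {x : ℕ → E} (hx : ∀ᶠ k in hyperfilter ℕ, nm (x k) ≤ (r k)⁻¹) :
    IsModerateVec b (ofSeq r) (hyperVec b x) := fun i => by
  obtain ⟨m, hm⟩ := isModerate_ofSeq.1 (isModerate_algebraMap h0 h2 K)
  rw [hyperVec_repr, isModerate_ofSeq]
  refine ⟨m + 1, ?_⟩
  filter_upwards [hx, hm] with k hk hmk
  have hrk := hr0 k
  calc |b.repr (x k) i| * r k ^ (m + 1) ≤ (|K| * (r k)⁻¹) * r k ^ (m + 1) := by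
        gcongr
        refine (hK _ _).trans ?_
        gcongr
        exact le_abs_self K
    _ = |K| * r k ^ m := by rw [pow_succ]; field_simp
    _ ≤ 1 := hmk

end Reduction

section Escape

open Module Filter Hyperreal
open scoped TensorProduct

variable {E : Type*} [Ring E] [Algebra ℝ E] {n : ℕ} {b : Basis (Fin n) ℝ E}
  {F : Type*} [Field F] [Algebra ℝ F] {φ : F →ₐ[ℝ] Hyperreal} {r : ℕ → ℝ} {nm : Seminorm ℝ E}

lemma exists_span_range_eq_toSubmodule {F T : Type*} [Field F] [Ring T] [Algebra F T]
    [FiniteDimensional F T] {W : Subalgebra F T} (hW : W ≠ ⊤) :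
    ∃ d < finrank F T, ∃ w : Fin d → T, Submodule.span F (Set.range w) = W.toSubmodule := by
  refine ⟨_, Submodule.finrank_lt fun h => hW (Algebra.toSubmodule_eq_top.1 h),
    fun i => (finBasis F W.toSubmodule i : T), ?_⟩
  have := congrArg (Submodule.map W.toSubmodule.subtype) (finBasis F W.toSubmodule).span_eq
  rwa [Submodule.map_span, ← Set.range_comp, Submodule.map_subtype_top] at this

lemma eventually_mem_span {ι : Type*} [Fintype ι] {w : ι → F ⊗[ℝ] E} {s : ι → ℕ → E}
    (hs : ∀ i, hyperVec b (s i) = hyperIncl φ E (w i)) {t : F ⊗[ℝ] E}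
    (ht : t ∈ Submodule.span F (Set.range w)) {x : ℕ → E} (hx : hyperVec b x = hyperIncl φ E t) :
    ∀ᶠ k in hyperfilter ℕ, x k ∈ Submodule.span ℝ (Set.range fun i => s i k) := by
  obtain ⟨c, rfl⟩ := (Submodule.mem_span_range_iff_exists_fun F).1 ht
  choose d hd using fun i => ofSeq_surjective (φ (c i))
  have h : hyperVec b x = hyperVec b (∑ i, fun k => d i k • s i k) := by
    simp only [hx, map_sum, hyperIncl_smul, hyperVec_smul, hd, hs]
  filter_upwards [(hyperVec_eq_iff b).1 h] with k hk
  rw [hk, Finset.sum_apply]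
  exact Submodule.sum_mem _ fun i _ =>
    Submodule.smul_mem _ _ (Submodule.subset_span ⟨i, rfl⟩)

/-- The elements of `F ⊗ E` represented by elements of sets away from subalgebras generate
`F ⊗ E` as an algebra. -/
lemma adjoin_represented_eq_top {K : ℝ} (hK : ∀ x i, |b.repr x i| ≤ K * nm x)
    (hr0 : ∀ k, 0 < r k) (hr2 : ∀ k, r k ≤ 1 / 2) (h0 : 0 < ofSeq r) (h2 : ofSeq r ≤ 1 / 2)
    (hFs : ∀ x, IsModerate (ofSeq r) x → ∃ f, IsNegligible (ofSeq r) (x - φ f))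
    {A : ℕ → Set E} (hA : ∀ k, A k ⊆ SBall nm 0 (r k)⁻¹)
    (hAw : ∀ k, AwayFromSubalgebras nm (r k) (A k)) :
    Algebra.adjoin F {t : F ⊗[ℝ] E | ∃ a : ℕ → E, (∀ᶠ k in hyperfilter ℕ, a k ∈ A k) ∧
      Represents b (ofSeq r) φ a t} = ⊤ := by
  set R := {t : F ⊗[ℝ] E | ∃ a : ℕ → E, (∀ᶠ k in hyperfilter ℕ, a k ∈ A k) ∧
      Represents b (ofSeq r) φ a t} with hR
  by_contra hne
  set W := Algebra.adjoin F R with hW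
  have : FiniteDimensional ℝ E := b.finiteDimensional_of_finite
  obtain ⟨d, hdim, w, hspan⟩ := exists_span_range_eq_toSubmodule hne
  rw [finrank_baseChange] at hdim
  choose s hs using fun i => hyperVec_surjective b (hyperIncl φ E (w i))
  have hmem : ∀ t ∈ W, ∀ x, hyperVec b x = hyperIncl φ E t →
      ∀ᶠ k in hyperfilter ℕ, x k ∈ Submodule.span ℝ (Set.range fun i => s i k) :=
    fun t ht x hx => eventually_mem_span hs (by rw [hspan]; exact ht) hx
  have hw : ∀ i, w i ∈ W := fun i => by
    rw [← Subalgebra.mem_toSubmodule, ← hspan]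
    exact Submodule.subset_span ⟨i, rfl⟩
  have hone : ∀ᶠ k in hyperfilter ℕ,
      (1 : E) ∈ Submodule.span ℝ (Set.range fun i => s i k) :=
    hmem 1 W.one_mem 1 (by rw [hyperIncl_one]; exact hyperVec_const b 1)
  have hmul : ∀ᶠ k in hyperfilter ℕ, ∀ i j,
      s i k * s j k ∈ Submodule.span ℝ (Set.range fun i => s i k) := by
    rw [eventually_all]
    intro i
    rw [eventually_all]
    intro j
    refine hmem (w i * w j) (W.mul_mem (hw i) (hw j)) (s i * s j) ?_
    rw [hyperVec_mul, hs, hs, map_mul]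
  have key : ∀ k, ∃ a : E, (1 : E) ∈ Submodule.span ℝ (Set.range fun i => s i k) →
      (∀ i j, s i k * s j k ∈ Submodule.span ℝ (Set.range fun i => s i k)) →
      a ∈ A k ∧ ∀ v ∈ Submodule.span ℝ (Set.range fun i => s i k), r k ≤ nm (a - v) := by
    intro k
    by_cases h1 : (1 : E) ∈ Submodule.span ℝ (Set.range fun i => s i k)
    swap
    · exact ⟨0, fun h => absurd h h1⟩
    by_cases h3 : ∀ i j, s i k * s j k ∈ Submodule.span ℝ (Set.range fun i => s i k)
    swap
    · exact ⟨0, fun _ h => absurd h h3⟩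
    have hVV : Submodule.span ℝ (Set.range fun i => s i k) *
        Submodule.span ℝ (Set.range fun i => s i k) ≤
        Submodule.span ℝ (Set.range fun i => s i k) := by
      rw [Submodule.span_mul_span, Submodule.span_le]
      rintro _ ⟨_, ⟨i, rfl⟩, _, ⟨j, rfl⟩, rfl⟩
      exact h3 i j
    let V : Subalgebra ℝ E := Submodule.toSubalgebra _ h1 fun x y hx hy =>
      hVV (Submodule.mul_mem_mul hx hy)
    have hV : V ≠ ⊤ := fun h => by
      have h4 : Submodule.span ℝ (Set.range fun i => s i k) = ⊤ := by
        rw [← Algebra.toSubmodule_eq_top, Submodule.toSubalgebra_toSubmodule] at h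
        exact h
      have h5 := finrank_range_le_card (R := ℝ) fun i => s i k
      rw [Set.finrank, h4, finrank_top, Fintype.card_fin] at h5
      omega
    obtain ⟨a, ha, had⟩ := hAw k V hV
    exact ⟨a, fun _ _ => ⟨ha, fun v hv => le_nm_of_le_sDist had hv⟩⟩
  choose a ha using key
  have ha' : ∀ᶠ k in hyperfilter ℕ, a k ∈ A k ∧
      ∀ v ∈ Submodule.span ℝ (Set.range fun i => s i k), r k ≤ nm (a k - v) := by
    filter_upwards [hone, hmul] with k h1 h3 using ha k h1 h3
  obtain ⟨t, ht⟩ := exists_represents hFs (x := a) <|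
    isModerateVec_of_nm_le hK hr0 h0 h2 <| ha'.mono fun k hk => by
      simpa [SBall] using hA k hk.1
  obtain ⟨x, hx⟩ := hyperVec_surjective b (hyperIncl φ E t)
  have htW : t ∈ W := Algebra.subset_adjoin ⟨a, ha'.mono fun k hk => hk.1, ht⟩
  rw [Represents, ← hx, ← map_sub] at ht
  obtain ⟨k, h1, h3, h4⟩ :=
    (ha'.and ((hmem t htW x hx).and (isNegligible_nm (nm := nm) h0 h2 ht 2))).exists
  have h5 := h1.2 _ h3
  rw [Pi.sub_apply] at h4
  nlinarith [hr0 k, hr2 k]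

lemma exists_represents_of_mem_prodIter (h0 : 0 < ofSeq r) (h2 : ofSeq r ≤ 1 / 2)
    (hF : ∀ f, IsModerate (ofSeq r) (φ f)) {A : ℕ → Set E} (m : ℕ) {t : F ⊗[ℝ] E}
    (ht : t ∈ ProdIter ({1} ∪ {t : F ⊗[ℝ] E | ∃ a : ℕ → E,
      (∀ᶠ k in hyperfilter ℕ, a k ∈ A k) ∧ Represents b (ofSeq r) φ a t}) m) :
    ∃ u : ℕ → E, (∀ᶠ k in hyperfilter ℕ, u k ∈ ProdIter ({1} ∪ A k) m) ∧
      Represents b (ofSeq r) φ u t := by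
  induction m generalizing t with
  | zero =>
    obtain rfl : t = 1 := ht
    exact ⟨1, .of_forall fun k => rfl, .one h0⟩
  | succ m ih =>
    obtain ⟨p, hp, q, hq, rfl⟩ := ht
    obtain ⟨u, hu, hup⟩ := ih hp
    obtain rfl | ⟨a, ha, haq⟩ := hq
    · refine ⟨u * 1, ?_, hup.mul h0 h2 hF (.one h0)⟩
      filter_upwards [hu] with k hk using ⟨_, hk, 1, Or.inl rfl, rfl⟩
    · refine ⟨u * a, ?_, hup.mul h0 h2 hF haq⟩
      filter_upwards [hu, ha] with k hk hak using ⟨_, hk, _, Or.inr hak, rfl⟩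

/-- `F ⊗ E` is spanned by the products `s y t` for any nonzero `y`, where `s` and `t` run through
spanning sets. -/
lemma span_mul_singleton_mul_eq_top [IsSimpleRing E] (φ : F →ₐ[ℝ] Hyperreal) (b : Basis (Fin n) ℝ E)
    {S : Set (F ⊗[ℝ] E)} (hS : Submodule.span F S = ⊤)
    {y : F ⊗[ℝ] E} (hy : y ≠ 0) : Submodule.span F (S * {y} * S) = ⊤ := by
  by_contra hne
  obtain ⟨f, hf0, hf⟩ := Submodule.exists_le_ker_of_lt_top _ (lt_top_iff_ne_top.2 hne)
  have hfy : ∀ p q, f (p * y * q) = 0 := by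
    intro p q
    have hle : Submodule.span F (S * {y} * S) =
        (⊤ : Submodule F (F ⊗[ℝ] E)) * Submodule.span F {y} * ⊤ := by
      rw [← hS, Submodule.span_mul_span, Submodule.span_mul_span]
    refine hf (hle ▸ ?_)
    exact Submodule.mul_mem_mul
      (Submodule.mul_mem_mul trivial (Submodule.mem_span_singleton_self y)) trivial
  obtain ⟨x, hx⟩ := hyperVec_surjective b (hyperIncl φ E y)
  have hx0 : ∀ᶠ k in hyperfilter ℕ, x k ≠ 0 := by
    refine Ultrafilter.eventually_not.2 ?_
    intro h
    have : hyperVec b x = hyperVec b 0 := (hyperVec_eq_iff b).2 h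
    rw [hx, map_zero] at this
    refine hy ((Algebra.TensorProduct.basis F b).ext_elem fun i => ?_)
    have h3 := hyperIncl_repr b φ y i
    rw [this] at h3
    simpa using h3.symm
  refine hf0 ((Algebra.TensorProduct.basis F b).ext fun l => ?_)
  have key : ∀ k, ∃ c : Fin n → Fin n → ℝ, x k ≠ 0 → b l = ∑ i, ∑ j, c i j • (b i * x k * b j) :=
    fun k => by
      by_cases h : x k = 0
      · exact ⟨0, fun h' => absurd h h'⟩
      · obtain ⟨c, hc⟩ := exists_eq_sum_basis_mul_mul_basis b h (b l)
        exact ⟨c, fun _ => hc⟩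
  choose c hc using key
  have hsum : hyperVec b (fun _ => b l) =
      hyperVec b (∑ i, ∑ j, fun k => c k i j • (b i * x k * b j)) := by
    rw [hyperVec_eq_iff]
    filter_upwards [hx0] with k hk
    simpa using hc k hk
  have hterm : ∀ i j, hyperVec b (fun k => c k i j • (b i * x k * b j)) =
      ofSeq (fun k => c k i j) • hyperIncl φ E ((1 ⊗ₜ b i) * y * (1 ⊗ₜ b j)) := by
    intro i j
    rw [hyperVec_smul, map_mul, map_mul, ← hx]
    have h3 : ∀ i, hyperIncl φ E (1 ⊗ₜ b i) = hyperVec b fun _ => b i := fun i => by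
      rw [hyperVec_const]; simp [hyperIncl]
    rw [h3, h3, ← hyperVec_mul, ← hyperVec_mul]
    rfl
  let g : Hyperreal ⊗[ℝ] E →ₗ[Hyperreal] Hyperreal :=
    (Algebra.TensorProduct.basis Hyperreal b).constr ℝ
      fun i => φ (f (Algebra.TensorProduct.basis F b i))
  have hg : ∀ t, g (hyperIncl φ E t) = φ (f t) := by
    intro t
    simp only [g, Basis.constr_apply_fintype, Basis.equivFun_apply, hyperIncl_repr]
    conv_rhs => rw [← (Algebra.TensorProduct.basis F b).sum_repr t]
    simp
  have h4 := congrArg g hsum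
  simp only [map_sum, hterm, map_smul, hg, hfy] at h4
  have h5 : hyperVec b (fun _ => b l) = hyperIncl φ E (Algebra.TensorProduct.basis F b l) := by
    rw [hyperVec_const]; simp [hyperIncl]
  rw [h5, hg] at h4
  simpa using h4

end Escape

section MainArgument

open Module Filter Hyperreal
open scoped TensorProduct

variable {E : Type*} [Ring E] [Algebra ℝ E]
  {F : Type*} [Field F] [Algebra ℝ F] {φ : F →ₐ[ℝ] Hyperreal} {r : ℕ → ℝ} {nm : Seminorm ℝ E}

/-- Sequences representing a basis of `F ⊗ E` are eventually almost orthonormal bases of `E`. -/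
lemma eventually_sAlmostONB_of_represents [FiniteDimensional ℝ E]
    {b : Basis (Fin (finrank ℝ E)) ℝ E} {K : ℝ} (hK : ∀ x i, |b.repr x i| ≤ K * nm x)
    (hr0 : ∀ k, 0 < r k) (hr2 : ∀ k, r k ≤ 1 / 2) (h0 : 0 < ofSeq r) (h2 : ofSeq r ≤ 1 / 2)
    (hF : ∀ f, IsModerate (ofSeq r) (φ f))
    (T : Basis (Fin (finrank ℝ E)) F (F ⊗[ℝ] E)) {a : Fin (finrank ℝ E) → ℕ → E}
    (ha : ∀ l, Represents b (ofSeq r) φ (a l) (T l)) :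
    ∃ M : ℕ, ∀ᶠ k in hyperfilter ℕ, ∀ s, 0 < s → s ≤ r k ^ M →
      Submodule.span ℝ (Set.range fun l => a l k) = ⊤ ∧ SAlmostONB nm s fun l => a l k := by
  have hr1 : ∀ k, r k ≤ 1 := fun k => (hr2 k).trans (by norm_num)
  choose N hN using fun i j => ofSeq_surjective (φ (T.repr (Algebra.TensorProduct.basis F b j) i))
  have hNmod : ∀ i j, IsModerate (ofSeq r) (ofSeq (N i j)) := fun i j => hN i j ▸ hF _
  have hdual : ∀ i l, ∑ j, T.repr (Algebra.TensorProduct.basis F b j) i *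
      (Algebra.TensorProduct.basis F b).repr (T l) j = if i = l then 1 else 0 := fun i l => by
    have := congrArg (fun z => T.repr z i) ((Algebra.TensorProduct.basis F b).sum_repr (T l))
    simp only [map_sum, map_smul, Basis.repr_self, Finsupp.coe_finsetSum, Finset.sum_apply,
      Finsupp.smul_apply, smul_eq_mul, Finsupp.single_apply] at this
    simp only [eq_comm (a := i), ← this, mul_comm]
  have happrox : ∀ i l, IsNegligible (ofSeq r)
      (ofSeq fun k => ∑ j, N i j k * b.repr (a l k) j - if i = l then 1 else 0) := fun i l => by
    have h : (ofSeq fun k => ∑ j, N i j k * b.repr (a l k) j - if i = l then 1 else 0) =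
        ∑ j, ofSeq (N i j) * (Algebra.TensorProduct.basis Hyperreal b).repr
          (hyperVec b (a l) - hyperIncl φ E (T l)) j := by
      simp only [map_sub, Finsupp.sub_apply, mul_sub, Finset.sum_sub_distrib, hyperVec_repr,
        hyperIncl_repr, ofSeq_sub, ofSeq_sum, ofSeq_mul]
      congr 1
      simp only [hN, ← map_mul, ← map_sum, hdual]
      split_ifs
      · rw [map_one, ofSeq_one]
      · rw [map_zero, ofSeq_zero]
    rw [h]
    exact .sum h0 h2 _ _ fun j _ => (ha l j).mul_left h0 (hNmod i j)
  obtain ⟨p, hp⟩ := exists_nat_gt (2 * finrank ℝ E : ℝ)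
  have hsmall : ∀ᶠ k in hyperfilter ℕ, ∀ i l,
      |∑ j, N i j k * b.repr (a l k) j - if i = l then 1 else 0| ≤ 1 / (2 * finrank ℝ E) := by
    rw [eventually_all]
    intro i
    rw [eventually_all]
    intro l
    filter_upwards [isNegligible_ofSeq.1 (happrox i l) p] with k hk
    have hn0 : (0 : ℝ) < finrank ℝ E := by exact_mod_cast Fin.pos i
    calc _ ≤ r k ^ p := hk
      _ ≤ (1 / 2) ^ p := pow_le_pow_left₀ (hr0 k).le (hr2 k) p
      _ = 1 / 2 ^ p := by rw [one_div_pow]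
      _ ≤ 1 / (2 * finrank ℝ E) := by
        refine one_div_le_one_div_of_le (by positivity) (hp.le.trans ?_)
        exact_mod_cast (Nat.lt_two_pow_self (n := p)).le
  have hQ : IsModerate (ofSeq r) (ofSeq fun k => 2 * K * ∑ i, ∑ j, |N i j k|) := by
    rw [ofSeq_mul]
    refine (isModerate_algebraMap h0 h2 (2 * K)).mul h0 ?_
    simp only [ofSeq_sum, ofSeq_abs]
    refine .sum h0 h2 _ _ fun i _ => .sum h0 h2 _ _ fun j _ => ?_
    simpa [IsModerate] using hNmod i j
  obtain ⟨M₁, hM₁⟩ := isModerate_ofSeq.1 hQ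
  choose M₂ hM₂ using fun l => isModerate_nm (nm := nm) h0 h2 ((ha l).isModerateVec h0 h2 hF)
  refine ⟨M₁ + ∑ l, M₂ l, ?_⟩
  filter_upwards [hsmall, hM₁, eventually_all.2 hM₂] with k hk1 hk2 hk3 s hs hsM
  have hcoeff := abs_coeff_le_of_approx_dual hK (fun l => a l k) (fun i j => N i j k) hk1
  have hle : ∀ m ≤ M₁ + ∑ l, M₂ l, s ≤ r k ^ m := fun m hm =>
    hsM.trans (pow_le_pow_of_le_one (hr0 k).le (hr1 k) hm)
  refine ⟨span_range_eq_top_of_coeff_le _ hcoeff, sAlmostONB_of_coeff_le _ hcoeff hs ?_ ?_⟩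
  · refine le_trans ?_ hk2
    exact mul_le_mul (le_abs_self _) (hle _ (Nat.le_add_right _ _)) hs.le (abs_nonneg _)
  · intro l
    refine le_trans ?_ (hk3 l)
    refine mul_le_mul_of_nonneg_left (hle _ ?_) (apply_nonneg nm _)
    exact (Finset.single_le_sum (fun _ _ => Nat.zero_le _) (Finset.mem_univ l)).trans
      (Nat.le_add_left _ _)

lemma eventually_exists_sAlmostONB [FiniteDimensional ℝ E] [IsSimpleRing E]
    (hnm : ∀ x : E, nm x = 0 → x = 0) (hr0 : ∀ k, 0 < r k) (hr2 : ∀ k, r k ≤ 1 / 2)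
    (h0 : 0 < ofSeq r) (h2 : ofSeq r ≤ 1 / 2) (hF : ∀ f, IsModerate (ofSeq r) (φ f))
    (hFs : ∀ x, IsModerate (ofSeq r) x → ∃ f, IsNegligible (ofSeq r) (x - φ f))
    {A : ℕ → Set E} (hA : ∀ k, A k ⊆ SBall nm 0 (r k)⁻¹)
    (hAw : ∀ k, AwayFromSubalgebras nm (r k) (A k)) {η : ℕ → E} (hη : ∀ k, r k ≤ nm (η k))
    (hη' : ∀ k, nm (η k) ≤ (r k)⁻¹) :
    ∃ M : ℕ, ∀ᶠ k in hyperfilter ℕ, ∀ s, 0 < s → s ≤ r k ^ M →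
      ∃ a : Fin (finrank ℝ E) → E,
        (∀ l, a l ∈ ProdIter ({1} ∪ A k) (finrank ℝ E) * {η k} *
          ProdIter ({1} ∪ A k) (finrank ℝ E)) ∧
        Submodule.span ℝ (Set.range a) = ⊤ ∧ SAlmostONB nm s a := by
  obtain ⟨K, -, hK⟩ := exists_abs_repr_le nm hnm (finBasis ℝ E)
  set b := finBasis ℝ E
  set R := {t : F ⊗[ℝ] E | ∃ a : ℕ → E, (∀ᶠ k in hyperfilter ℕ, a k ∈ A k) ∧
    Represents b (ofSeq r) φ a t}
  have hdim : finrank F (F ⊗[ℝ] E) = finrank ℝ E := finrank_baseChange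
  have hadj : Algebra.adjoin F ({1} ∪ R) = ⊤ := by
    rw [eq_top_iff, ← adjoin_represented_eq_top hK hr0 hr2 h0 h2 hFs hA hAw]
    exact Algebra.adjoin_mono Set.subset_union_right
  have hspan := span_prodIter_eq_top ({1} ∪ R) (Or.inl rfl) hadj
  rw [hdim] at hspan
  obtain ⟨y, hy⟩ := exists_represents hFs (x := η) <|
    isModerateVec_of_nm_le (b := b) hK hr0 h0 h2 (.of_forall hη')
  have hy0 : y ≠ 0 := by
    rintro rfl
    rw [Represents, map_zero, sub_zero] at hy
    obtain ⟨k, hk⟩ := (isNegligible_nm (nm := nm) h0 h2 hy 2).exists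
    nlinarith [hr0 k, hr2 k, hη k]
  have htop := span_mul_singleton_mul_eq_top φ b hspan hy0
  have hex := Submodule.exists_fun_fin_finrank_span_eq F
    (ProdIter ({1} ∪ R) (finrank ℝ E) * {y} * ProdIter ({1} ∪ R) (finrank ℝ E))
  rw [htop, finrank_top, hdim] at hex
  obtain ⟨t, ht, htspan, hli⟩ := hex
  have hrep : ∀ l, ∃ a : ℕ → E, (∀ᶠ k in hyperfilter ℕ,
      a k ∈ ProdIter ({1} ∪ A k) (finrank ℝ E) * {η k} * ProdIter ({1} ∪ A k) (finrank ℝ E)) ∧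
      Represents b (ofSeq r) φ a (t l) := fun l => by
    obtain ⟨_, ⟨p, hp, _, rfl, rfl⟩, q, hq, hl⟩ := ht l
    obtain ⟨u, hu, hup⟩ := exists_represents_of_mem_prodIter h0 h2 hF _ hp
    obtain ⟨v, hv, hvq⟩ := exists_represents_of_mem_prodIter h0 h2 hF _ hq
    refine ⟨u * η * v, ?_, hl ▸ (hup.mul h0 h2 hF hy).mul h0 h2 hF hvq⟩
    filter_upwards [hu, hv] with k huk hvk
      using Set.mul_mem_mul (Set.mul_mem_mul huk (Set.mem_singleton _)) hvk
  choose a ha haT using hrep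
  obtain ⟨M, hM⟩ := eventually_sAlmostONB_of_represents (nm := nm) hK hr0 hr2 h0 h2 hF
    (Basis.mk hli htspan.ge) (a := a) fun l => by rw [Basis.mk_apply]; exact haT l
  refine ⟨M, ?_⟩
  filter_upwards [hM, eventually_all.2 ha] with k hk hak s hs hsM
    using ⟨fun l => a l k, hak, hk s hs hsM⟩

end MainArgument


/-- **Proposition 3.3** (escape from linear subspaces by multiplication): if `A` is `ρ`-away
from subalgebras of the simple normed algebra `E` and `ρ ≤ nm η ≤ ρ⁻¹`, then the product set
`A₁ⁿ η A₁ⁿ`, with `A₁ = {1} ∪ A` and `n = dim_ℝ E`, contains a `c ρ^C`-almost orthonormal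
basis of `E`. -/
theorem product_set_contains_almost_orthonormal_basis
    {E : Type*} [Ring E] [Algebra ℝ E] [FiniteDimensional ℝ E] [IsSimpleRing E]
    (nm : Seminorm ℝ E) (hnm : ∀ x : E, nm x = 0 → x = 0) :
    ∃ C : ℝ, 1 ≤ C ∧ ∃ c : ℝ, 0 < c ∧
      ∀ ρ : ℝ, 0 < ρ → ρ ≤ 1 / 2 →
        ∀ A : Set E,
          A ⊆ SBall nm 0 ρ⁻¹ →
          AwayFromSubalgebras nm ρ A →
          ∀ η : E, ρ ≤ nm η → nm η ≤ ρ⁻¹ →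
            ∃ a : Fin (Module.finrank ℝ E) → E,
              (∀ k, a k ∈
                ProdIter ({1} ∪ A) (Module.finrank ℝ E) * {η} *
                  ProdIter ({1} ∪ A) (Module.finrank ℝ E)) ∧
              Submodule.span ℝ (Set.range a) = ⊤ ∧
              SAlmostONB nm (c * ρ ^ C) a := by
  by_contra hcon
  push Not at hcon
  have key : ∀ k : ℕ, ∃ ρ : ℝ, 0 < ρ ∧ ρ ≤ 1 / 2 ∧ ∃ A : Set E, A ⊆ SBall nm 0 ρ⁻¹ ∧
      AwayFromSubalgebras nm ρ A ∧ ∃ η : E, ρ ≤ nm η ∧ nm η ≤ ρ⁻¹ ∧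
        ∀ a : Fin (Module.finrank ℝ E) → E,
          (∀ l, a l ∈ ProdIter ({1} ∪ A) (Module.finrank ℝ E) * {η} *
            ProdIter ({1} ∪ A) (Module.finrank ℝ E)) →
          Submodule.span ℝ (Set.range a) = ⊤ → ¬ SAlmostONB nm (ρ ^ (k + 1)) a := fun k => by
    have h := hcon ((k + 1 : ℕ) : ℝ) (by simp) 1 one_pos
    simpa only [Real.rpow_natCast, one_mul] using h
  choose r hr0 hr2 A hA hAw η hη hη' hno using key
  have h0 : 0 < Hyperreal.ofSeq r := by
    rw [← Hyperreal.ofSeq_zero, Hyperreal.ofSeq_lt_ofSeq]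
    exact .of_forall hr0
  have h2 : Hyperreal.ofSeq r ≤ 1 / 2 := by
    have : (1 / 2 : Hyperreal) = Hyperreal.ofSeq fun _ => 1 / 2 := rfl
    rw [this, Hyperreal.ofSeq_le_ofSeq]
    exact .of_forall hr2
  obtain ⟨F, hF, hFs⟩ :=
    exists_field_of_representatives h0 h2 Hyperreal.exists_mem_uIcc_eval_eq_zero
  obtain ⟨M, hM⟩ := eventually_exists_sAlmostONB (φ := F.val) hnm hr0 hr2 h0 h2
    (fun f => hF _ f.2) (fun x hx => let ⟨f, hf, hfx⟩ := hFs x hx; ⟨⟨f, hf⟩, hfx⟩)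
    hA hAw hη hη'
  obtain ⟨k, hk, hMk⟩ :=
    (hM.and ((Filter.eventually_ge_atTop M).filter_mono Nat.hyperfilter_le_atTop)).exists
  obtain ⟨a, ha, hspan, hONB⟩ := hk (r k ^ (k + 1)) (pow_pos (hr0 k) _)
    (pow_le_pow_of_le_one (hr0 k).le ((hr2 k).trans (by norm_num)) (by omega))
  exact hno k a ha hspan hONB
end

section
/- Let n be a positive integer. For every κ > 0 and all 0 < σ < τ there exist ε > 0 and δ₀ > 0 (depending on n, κ, σ, τ) such that for all 0 < δ < δ₀ the following holds. Let X ⊆ ℝⁿ and let μ be a Borel probability measure on End(ℝⁿ) satisfying: (i) X ⊆ B(0, δ^{-ε}); (ii) for every ρ ≥ δ, N_ρ(X) ≥ δ^ε ρ^{-κ}; (iii) N_δ(X) ≤ δ^{-σ-ε}; (iv) the support of μ is contained in B(0, δ^{-ε}); (v) for every ρ ≥ δ and all v, w ∈ ℝⁿ with ‖v‖ = 1, μ({f ∈ End(ℝⁿ) : ‖f v − w‖ ≤ ρ}) ≤ δ^{-ε} ρ^τ. Then either N_δ(X + X) ≥ (δ^{-ε}/2) N_δ(X), or there exists f in the support of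 μ with N_δ(X + fX) ≥ (δ^{-ε}/2) N_δ(X), where fX = {f x : x ∈ X}. -/
open Pointwise MeasureTheory

/-- Covering number at scale `δ` of a subset of a (pseudo)metric space: the least number of
closed `δ`-balls needed to cover `S`. -/
noncomputable def covNum {X : Type*} [PseudoMetricSpace X] (δ : ℝ) (S : Set X) : ℕ :=
  sInf {N : ℕ | ∃ F : Finset X, F.card ≤ N ∧ S ⊆ ⋃ x ∈ F, Metric.closedBall x δ}

/-- The (topological) support of a measure: the set of points all of whose open
neighbourhoods have positive measure. -/
def msupport {α : Type*} [TopologicalSpace α] [MeasurableSpace α] (μ : Measure α) : Set α :=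
  {x | ∀ U : Set α, IsOpen U → x ∈ U → 0 < μ U}

open Metric

section Covering

variable {α : Type*} [PseudoMetricSpace α] {δ : ℝ} {S : Set α}

lemma covNum_le_card {F : Finset α} (hF : S ⊆ ⋃ x ∈ F, closedBall x δ) :
    covNum δ S ≤ F.card :=
  Nat.sInf_le ⟨F, le_rfl, hF⟩

/-- The covering number of a bounded set is attained. -/
lemma exists_cover_card_le_covNum [ProperSpace α] (hδ : 0 < δ) (hS : Bornology.IsBounded S) :
    ∃ F : Finset α, F.card ≤ covNum δ S ∧ S ⊆ ⋃ x ∈ F, closedBall x δ := by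
  obtain ⟨t, ht, hSt⟩ := Metric.totallyBounded_iff.1
    (hS.isCompact_closure.totallyBounded.subset subset_closure) δ hδ
  refine Nat.sInf_mem (s := {N : ℕ | ∃ F : Finset α, F.card ≤ N ∧ S ⊆ ⋃ x ∈ F, closedBall x δ})
    ⟨ht.toFinset.card, ht.toFinset, le_rfl, hSt.trans ?_⟩
  simp only [Set.Finite.mem_toFinset]
  exact Set.iUnion₂_mono fun x _ => ball_subset_closedBall

/-- A separated subset of a bounded set has at most as many points as the covering number. -/
lemma card_le_covNum [ProperSpace α] (hδ : 0 < δ) (hS : Bornology.IsBounded S)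
    {P : Finset α} (hPS : ↑P ⊆ S) (hP : ∀ x ∈ P, ∀ y ∈ P, dist x y ≤ 2 * δ → x = y) :
    P.card ≤ covNum δ S := by
  obtain ⟨F, hF, hSF⟩ := exists_cover_card_le_covNum hδ hS
  have hc : ∀ x ∈ P, ∃ c ∈ F, dist x c ≤ δ := fun x hx => by
    simpa using hSF (hPS hx)
  choose! c hcF hc using hc
  refine (Finset.card_le_card_of_injOn c hcF fun x hx y hy hxy => hP x hx y hy ?_).trans hF
  have h₁ := hc x hx
  have h₂ := hc y hy
  rw [← hxy] at h₂
  linarith [dist_triangle_right x y (c x)]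

/-- Bounded sets contain finite separated nets. -/
lemma exists_separated_net [ProperSpace α] (hδ : 0 < δ) (hS : Bornology.IsBounded S) :
    ∃ P : Finset α, ↑P ⊆ S ∧ (∀ x ∈ P, ∀ y ∈ P, dist x y ≤ 2 * δ → x = y) ∧
      S ⊆ ⋃ x ∈ P, closedBall x (2 * δ) := by
  classical
  let p : ℕ → Prop := fun k => ∃ P : Finset α, P.card = k ∧ ↑P ⊆ S ∧
    ∀ x ∈ P, ∀ y ∈ P, dist x y ≤ 2 * δ → x = y
  have h₀ : p 0 := ⟨∅, by simp⟩
  obtain ⟨P, hcard, hPS, hP⟩ : p (Nat.findGreatest p (covNum δ S)) :=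
    Nat.findGreatest_spec (Nat.zero_le _) h₀
  refine ⟨P, hPS, hP, fun z hz => ?_⟩
  by_contra hzP
  have hfar : ∀ x ∈ P, 2 * δ < dist z x := by simpa using hzP
  have hzP' : z ∉ P := fun h => by
    have := hfar z h
    rw [dist_self] at this
    linarith
  have hSins : (↑(insert z P) : Set α) ⊆ S := by
    simpa [Set.insert_subset_iff] using ⟨hz, hPS⟩
  have hins : ∀ x ∈ insert z P, ∀ y ∈ insert z P, dist x y ≤ 2 * δ → x = y := by
    intro x hx y hy hxy
    rcases Finset.mem_insert.1 hx with rfl | hx' <;> rcases Finset.mem_insert.1 hy with rfl | hy'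
    · rfl
    · exact absurd hxy (hfar y hy').not_ge
    · exact absurd (dist_comm x y ▸ hxy) (hfar x hx').not_ge
    · exact hP x hx' y hy' hxy
  have := Nat.le_findGreatest (P := p) (card_le_covNum hδ hS hSins hins)
    ⟨insert z P, rfl, hSins, hins⟩
  rw [Finset.card_insert_of_notMem hzP'] at this
  omega

end Covering

/-- In a proper normed space, a set covered by balls of radius `4 * δ` has covering number at
scale `δ` at most a constant times the number of these balls. -/
lemma exists_covNum_le_mul_card (E : Type*) [NormedAddCommGroup E] [NormedSpace ℝ E]
    [ProperSpace E] :
    ∃ C : ℕ, ∀ δ : ℝ, 0 < δ → ∀ (S : Set E) (P : Finset E),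
      S ⊆ ⋃ x ∈ P, closedBall x (4 * δ) → covNum δ S ≤ C * P.card := by
  classical
  obtain ⟨T, -, hT⟩ := exists_cover_card_le_covNum one_pos
    (isBounded_closedBall (x := (0 : E)) (r := 4))
  refine ⟨T.card, fun δ hδ S P hS => ?_⟩
  refine (covNum_le_card (F := Finset.image₂ (fun t x => x + δ • t) T P) fun z hz => ?_).trans
    (Finset.card_image₂_le _ _ _)
  obtain ⟨x, hx, hzx⟩ : ∃ x ∈ P, dist z x ≤ 4 * δ := by simpa using hS hz
  have hmem : δ⁻¹ • (z - x) ∈ closedBall (0 : E) 4 := by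
    rw [mem_closedBall_zero_iff, norm_smul, norm_inv, Real.norm_of_nonneg hδ.le, ← dist_eq_norm]
    rw [inv_mul_le_iff₀ hδ]
    linarith
  obtain ⟨t, ht, hdist⟩ : ∃ t ∈ T, dist (δ⁻¹ • (z - x)) t ≤ 1 := by simpa using hT hmem
  refine Set.mem_iUnion₂.2 ⟨x + δ • t, Finset.mem_image₂_of_mem ht hx, ?_⟩
  have : z - (x + δ • t) = δ • (δ⁻¹ • (z - x) - t) := by
    rw [smul_sub, smul_inv_smul₀ hδ.ne']
    abel
  rw [mem_closedBall, dist_eq_norm, this, norm_smul, Real.norm_of_nonneg hδ.le, ← dist_eq_norm]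
  exact mul_le_of_le_one_right hδ.le hdist

/-- Cauchy–Schwarz: a map from `A` to `F` has at least `|A| ^ 2 / |F|` collisions. -/
lemma card_sq_le_card_mul_card_collisions {ι β : Type*} [DecidableEq β]
    (A : Finset ι) (F : Finset β) (c : ι → β) (hc : ∀ a ∈ A, c a ∈ F) :
    A.card ^ 2 ≤ F.card * ((A ×ˢ A).filter fun p => c p.1 = c p.2).card := by
  have h₁ : ((A ×ˢ A).filter fun p => c p.1 = c p.2).card =
      ∑ b ∈ F, (A.filter fun a => c a = b).card ^ 2 := by
    rw [Finset.card_eq_sum_card_fiberwise (f := fun p : ι × ι => c p.1) (t := F)]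
    · refine Finset.sum_congr rfl fun b _ => ?_
      rw [sq, ← Finset.card_product]
      congr 1
      ext p
      simp only [Finset.mem_filter, Finset.mem_product]
      grind
    · intro p hp
      exact hc _ (by simp_all)
  rw [h₁, Finset.card_eq_sum_card_fiberwise (f := c) (t := F) hc]
  exact sq_sum_le_card_mul_sum_sq

/-- If almost every point lies in at least `L` of finitely many sets, then the measures of these
sets sum to at least `L`. -/
lemma le_sum_measureReal_of_le_card {Ω ι : Type*} [MeasurableSpace Ω] (μ : Measure Ω)
    [IsProbabilityMeasure μ] (Q : Finset ι) (A : ι → Set Ω) (hA : ∀ q ∈ Q, MeasurableSet (A q))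
    (L : ℝ) [∀ ω, DecidablePred fun q => ω ∈ A q]
    (hL : ∀ᵐ ω ∂μ, L ≤ ((Q.filter fun q => ω ∈ A q).card : ℝ)) :
    L ≤ ∑ q ∈ Q, μ.real (A q) := by
  have hint : ∀ q ∈ Q, Integrable ((A q).indicator (1 : Ω → ℝ)) μ := fun q hq =>
    (integrable_const (1 : ℝ)).indicator (hA q hq)
  calc L = ∫ _, L ∂μ := by simp
    _ ≤ ∫ ω, ∑ q ∈ Q, (A q).indicator (1 : Ω → ℝ) ω ∂μ := by
        refine integral_mono_ae (integrable_const _) (integrable_finsetSum _ hint) ?_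
        filter_upwards [hL] with ω hω
        refine hω.trans (le_of_eq ?_)
        simp [Set.indicator_apply]
    _ = ∑ q ∈ Q, μ.real (A q) := by
        rw [integral_finsetSum _ hint]
        exact Finset.sum_congr rfl fun q hq => integral_indicator_one (hA q hq)

lemma msupport_mem_ae {α : Type*} [TopologicalSpace α] [SecondCountableTopology α]
    [MeasurableSpace α] (μ : Measure α) : ∀ᵐ x ∂μ, x ∈ msupport μ := by
  refine measure_null_of_locally_null _ fun x hx => ?_
  simp only [msupport, Set.mem_compl_iff, Set.mem_ofPred_eq, not_forall, not_lt,
    nonpos_iff_eq_zero] at hx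
  obtain ⟨U, hU, hxU, hμ⟩ := hx
  exact ⟨U, mem_nhdsWithin_of_mem_nhds (hU.mem_nhds hxU), hμ⟩

section Growth

variable {E : Type*} [NormedAddCommGroup E] {X : Set E} {δ r : ℝ}

/-- A small sumset forces a set which is spread out at scale `r` to have few separated points in
each ball of radius `r`. -/
lemma covNum_mul_card_ball_le [ProperSpace E] (hδ : 0 < δ) (hδr : δ ≤ r)
    (hX : Bornology.IsBounded X) {P : Finset E} (hPX : ↑P ⊆ X)
    (hP : ∀ x ∈ P, ∀ y ∈ P, dist x y ≤ 2 * (2 * δ) → x = y) (y : E) :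
    covNum (4 * r) X * (P.filter fun y' => dist y y' ≤ r).card ≤ covNum δ (X + X) := by
  classical
  have hr : 0 < r := hδ.trans_le hδr
  obtain ⟨Q, hQX, hQ, hXQ⟩ := exists_separated_net (δ := 2 * r) (by positivity) hX
  have hle : covNum (4 * r) X ≤ Q.card := by
    refine covNum_le_card ?_
    rwa [← mul_assoc, show (2 : ℝ) * 2 = 4 by norm_num] at hXQ
  refine (Nat.mul_le_mul_right _ hle).trans ?_
  set B := P.filter fun y' => dist y y' ≤ r
  have key : ∀ q ∈ Q, ∀ b ∈ B, ∀ q' ∈ Q, ∀ b' ∈ B, dist (q + b) (q' + b') ≤ 2 * δ →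
      q = q' ∧ b = b' := by
    intro q hq b hb q' hq' b' hb' h
    obtain ⟨hbP, hb⟩ := Finset.mem_filter.1 hb
    obtain ⟨hbP', hb'⟩ := Finset.mem_filter.1 hb'
    obtain rfl : q = q' := by
      refine hQ q hq q' hq' ?_
      have h₁ : dist q q' ≤ dist (q + b) (q' + b') + dist b b' := by
        rw [dist_eq_norm, dist_eq_norm, dist_eq_norm]
        refine le_trans (le_of_eq ?_) (norm_sub_le _ _)
        congr 1
        abel
      have h₂ := dist_triangle_left b b' y
      linarith
    rw [dist_add_left] at h
    exact ⟨rfl, hP b hbP b' hbP' (by linarith)⟩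
  have hcard : Q.card * B.card = (Finset.image₂ (· + ·) Q B).card := by
    refine (Finset.card_image₂_iff.2 ?_).symm
    rintro ⟨q, b⟩ h ⟨q', b'⟩ h' heq
    obtain ⟨hq, hb⟩ := Set.mem_prod.1 h
    obtain ⟨hq', hb'⟩ := Set.mem_prod.1 h'
    obtain ⟨h₁, h₂⟩ := key q hq b hb q' hq' b' hb' (by
      rw [show q + b = q' + b' from heq, dist_self]
      positivity)
    exact Prod.ext h₁ h₂
  rw [hcard]
  refine card_le_covNum hδ (hX.add hX) ?_ ?_
  · rw [Finset.coe_image₂]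
    rintro _ ⟨q, hq, b, hb, rfl⟩
    exact Set.add_mem_add (hQX hq) (hPX (Finset.mem_filter.1 hb).1)
  · intro u hu v hv huv
    obtain ⟨q, hq, b, hb, rfl⟩ := Finset.mem_image₂.1 hu
    obtain ⟨q', hq', b', hb', rfl⟩ := Finset.mem_image₂.1 hv
    obtain ⟨rfl, rfl⟩ := key q hq b hb q' hq' b' hb' huv
    rfl

variable [NormedSpace ℝ E]

/-- If `X + f X` has a small covering number, then there are many approximate collisions
`x + f y ≈ x' + f y'`. -/
lemma card_pow_four_le_covNum_mul_card [ProperSpace E] (hδ : 0 < δ)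
    (hX : Bornology.IsBounded X) {P : Finset E} (hPX : ↑P ⊆ X) (f : E →L[ℝ] E) :
    P.card ^ 4 ≤ covNum δ (X + (fun x => f x) '' X) *
      (((P ×ˢ P) ×ˢ (P ×ˢ P)).filter fun q =>
        ‖f (q.1.2 - q.2.2) - (q.2.1 - q.1.1)‖ ≤ 2 * δ).card := by
  classical
  obtain ⟨F, hF, hXF⟩ := exists_cover_card_le_covNum hδ
    (hX.add (f.lipschitz.isBounded_image hX))
  have hc : ∀ a ∈ P ×ˢ P, ∃ c ∈ F, dist (a.1 + f a.2) c ≤ δ := fun a ha => by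
    obtain ⟨h₁, h₂⟩ := Finset.mem_product.1 ha
    simpa using hXF (Set.add_mem_add (hPX h₁) ⟨a.2, hPX h₂, rfl⟩)
  choose! c hcF hc using hc
  calc P.card ^ 4 = (P ×ˢ P).card ^ 2 := by rw [Finset.card_product]; ring
    _ ≤ F.card * _ := card_sq_le_card_mul_card_collisions _ F c hcF
    _ ≤ _ := Nat.mul_le_mul hF (Finset.card_le_card ?_)
  intro q hq
  obtain ⟨hq, heq⟩ := Finset.mem_filter.1 hq
  refine Finset.mem_filter.2 ⟨hq, ?_⟩
  have h₁ := hc _ (Finset.mem_product.1 hq).1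
  have h₂ := hc _ (Finset.mem_product.1 hq).2
  rw [← heq] at h₂
  have h₃ := dist_triangle_right (q.1.1 + f q.1.2) (q.2.1 + f q.2.2) (c q.1)
  rw [dist_eq_norm (q.1.1 + f q.1.2) (q.2.1 + f q.2.2)] at h₃
  rw [map_sub, show f q.1.2 - f q.2.2 - (q.2.1 - q.1.1) =
    q.1.1 + f q.1.2 - (q.2.1 + f q.2.2) by abel]
  linarith

/-- There are few approximate collisions `x + f y ≈ x' + f y'` with `y` and `y'` close. -/
lemma card_near_collisions_le {P : Finset E}
    (hP : ∀ x ∈ P, ∀ y ∈ P, dist x y ≤ 2 * (2 * δ) → x = y) (f : E →L[ℝ] E) (b : ℕ)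
    (hb : ∀ y ∈ P, (P.filter fun y' => dist y y' ≤ r).card ≤ b) :
    (((P ×ˢ P) ×ˢ (P ×ˢ P)).filter fun q =>
      ‖f (q.1.2 - q.2.2) - (q.2.1 - q.1.1)‖ ≤ 2 * δ ∧ dist q.1.2 q.2.2 ≤ r).card ≤
        b * P.card ^ 2 := by
  classical
  rw [sq, ← Finset.card_product]
  refine Finset.card_le_mul_card_image_of_maps_to (f := Prod.fst)
    (fun q hq => (Finset.mem_product.1 (Finset.mem_filter.1 hq).1).1) b ?_
  rintro ⟨x, y⟩ hxy
  refine le_trans ?_ (hb y (Finset.mem_product.1 hxy).2)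
  refine Finset.card_le_card_of_injOn (fun q => q.2.2) ?_ ?_
  · rintro ⟨⟨x₁, y₁⟩, ⟨x', y'⟩⟩ hq
    simp only [Finset.coe_filter, Finset.mem_filter, Finset.mem_product, Set.mem_ofPred_eq,
      Prod.mk.injEq] at hq ⊢
    obtain ⟨⟨⟨-, -, hy'⟩, -, h⟩, -, rfl⟩ := hq
    exact ⟨hy', h⟩
  · rintro ⟨⟨x₁, y₁⟩, ⟨x', y'⟩⟩ hq ⟨⟨x₂, y₂⟩, ⟨x'', y''⟩⟩ hq' heq
    simp only [Finset.coe_filter, Finset.mem_filter, Finset.mem_product, Set.mem_ofPred_eq,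
      Prod.mk.injEq] at hq hq' heq ⊢
    obtain ⟨⟨⟨-, hx', -⟩, h, -⟩, rfl, rfl⟩ := hq
    obtain ⟨⟨⟨-, hx'', -⟩, h', -⟩, rfl, rfl⟩ := hq'
    subst heq
    refine ⟨⟨rfl, rfl⟩, hP _ hx' _ hx'' ?_, rfl⟩
    have h₁ := norm_sub_le (f (y₂ - y') - (x'' - x₂)) (f (y₂ - y') - (x' - x₂))
    rw [show f (y₂ - y') - (x'' - x₂) - (f (y₂ - y') - (x' - x₂)) = x' - x'' by abel,
      ← dist_eq_norm] at h₁
    linarith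

/-- If `X + f X` has a small covering number and the balls of radius `r` contain few points of
`P`, then there are many approximate collisions `x + f y ≈ x' + f y'` with `y` and `y'` distant. -/
lemma le_card_far_collisions [ProperSpace E] (hδ : 0 < δ) (hX : Bornology.IsBounded X)
    {P : Finset E} (hPX : ↑P ⊆ X) (hP : ∀ x ∈ P, ∀ y ∈ P, dist x y ≤ 2 * (2 * δ) → x = y)
    (hp₀ : 0 < (P.card : ℝ)) (f : E →L[ℝ] E) {C t K : ℝ} (hC : 0 < C) (ht : 0 < t) (hK : 0 < K)
    (hf : (covNum δ (X + (fun x => f x) '' X) : ℝ) ≤ t⁻¹ / 2 * (C * P.card))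
    (hb : ∀ y ∈ P, ((P.filter fun y' => dist y y' ≤ r).card : ℝ) ≤ K * C * t ^ 2 * P.card / 2)
    (htCK : t * (C ^ 2 * K) ≤ 2) :
    (P.card : ℝ) ^ 3 * t / C ≤ ((((P ×ˢ P) ×ˢ (P ×ˢ P)).filter fun q =>
      ‖f (q.1.2 - q.2.2) - (q.2.1 - q.1.1)‖ ≤ 2 * δ ∧ ¬ dist q.1.2 q.2.2 ≤ r).card : ℝ) := by
  classical
  set p : ℝ := (P.card : ℝ) with hp
  have h₁ := card_pow_four_le_covNum_mul_card hδ hX hPX f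
  have h₂ := card_near_collisions_le hP f ⌊K * C * t ^ 2 * p / 2⌋₊
    fun y hy => Nat.le_floor (hb y hy)
  rw [← Finset.card_filter_add_card_filter_not
    (s := ((P ×ˢ P) ×ˢ (P ×ˢ P)).filter _) (fun q => dist q.1.2 q.2.2 ≤ r),
    Finset.filter_filter, Finset.filter_filter] at h₁
  set u := (((P ×ˢ P) ×ˢ (P ×ˢ P)).filter fun q =>
    ‖f (q.1.2 - q.2.2) - (q.2.1 - q.1.1)‖ ≤ 2 * δ ∧ dist q.1.2 q.2.2 ≤ r).card
  set v := (((P ×ˢ P) ×ˢ (P ×ˢ P)).filter fun q =>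
    ‖f (q.1.2 - q.2.2) - (q.2.1 - q.1.1)‖ ≤ 2 * δ ∧ ¬ dist q.1.2 q.2.2 ≤ r).card
  have h₄ : p ^ 4 ≤ t⁻¹ / 2 * (C * p) * (u + v) := by
    have h : p ^ 4 ≤ (covNum δ (X + (fun x => f x) '' X) : ℝ) * (u + v) := by
      rw [hp]
      exact_mod_cast h₁
    exact h.trans (mul_le_mul_of_nonneg_right hf (by positivity))
  have h₅ : (u : ℝ) ≤ K * C * t ^ 2 * p / 2 * p ^ 2 := by
    have h : (u : ℝ) ≤ ⌊K * C * t ^ 2 * p / 2⌋₊ * (P.card : ℝ) ^ 2 := by exact_mod_cast h₂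
    exact h.trans (mul_le_mul_of_nonneg_right (Nat.floor_le (by positivity)) (by positivity))
  have h₇ : 2 * (p ^ 3 * t / C) ≤ u + v := by
    have h := mul_le_mul_of_nonneg_left h₄ (show 0 ≤ 2 * t / (C * p) by positivity)
    calc 2 * (p ^ 3 * t / C) = 2 * t / (C * p) * p ^ 4 := by field_simp
      _ ≤ _ := h
      _ = _ := by field_simp
  have h₈ : (u : ℝ) ≤ p ^ 3 * t / C := by
    refine h₅.trans ?_
    have h := mul_le_mul_of_nonneg_left htCK (show 0 ≤ p ^ 3 * t / (2 * C) by positivity)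
    calc _ = p ^ 3 * t / (2 * C) * (t * (C ^ 2 * K)) := by field_simp
      _ ≤ _ := h
      _ = _ := by field_simp
  linarith

/-- The non-concentration of `μ` in unit directions, applied to a vector of norm at least `r`. -/
lemma measureReal_norm_sub_le [MeasurableSpace (E →L[ℝ] E)] (μ : Measure (E →L[ℝ] E))
    [IsFiniteMeasure μ] {c : ℝ} (hc : 0 ≤ c) (hδ : 0 ≤ δ) (hr : 0 < r)
    (hμ : ∀ v w : E, ‖v‖ = 1 → μ {f | ‖f v - w‖ ≤ δ / r} ≤ ENNReal.ofReal c)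
    (u z : E) (hu : r ≤ ‖u‖) : μ.real {f | ‖f u - z‖ ≤ δ} ≤ c := by
  have hu₀ : 0 < ‖u‖ := hr.trans_le hu
  refine ENNReal.toReal_le_of_le_ofReal hc ((measure_mono ?_).trans
    (hμ (‖u‖⁻¹ • u) (‖u‖⁻¹ • z) ?_))
  · intro f hf
    have hf : ‖f u - z‖ ≤ δ := hf
    show ‖f (‖u‖⁻¹ • u) - ‖u‖⁻¹ • z‖ ≤ δ / r
    rw [map_smul, ← smul_sub, norm_smul, norm_inv, norm_norm, inv_mul_eq_div]
    gcongr
  · rw [norm_smul, norm_inv, norm_norm, inv_mul_cancel₀ hu₀.ne']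

end Growth

lemma one_le_mul_of_pow_three_le {p t C B R s : ℝ} (hp : 0 < p) (ht : 0 < t) (hC : 0 < C)
    (hR : 0 ≤ R) (h : p ^ 3 * t / C ≤ p ^ 4 * (t⁻¹ * R)) (hps : p ≤ s) (hs : s * R = B * t ^ 3) :
    1 ≤ t * (C * B) := by
  have h₁ : t ^ 2 / C ≤ B * t ^ 3 := by
    rw [← hs]
    refine le_trans ?_ (mul_le_mul_of_nonneg_right hps hR)
    have h := mul_le_mul_of_nonneg_left h (show 0 ≤ t / p ^ 3 by positivity)
    calc t ^ 2 / C = t / p ^ 3 * (p ^ 3 * t / C) := by field_simp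
      _ ≤ _ := h
      _ = _ := by field_simp
  rw [div_le_iff₀ hC] at h₁
  refine le_of_mul_le_mul_left ?_ (pow_pos ht 2)
  calc t ^ 2 * 1 = t ^ 2 := mul_one _
    _ ≤ _ := h₁
    _ = _ := by ring

/-- **Proposition 6.2** (growth under a spread-out family of linear maps): if `X ⊆ ℝⁿ` is
non-concentrated and not too large and the probability measure `μ` on `End(ℝⁿ)` is
non-degenerate in all directions, then `N_δ(X + X) + max_{f ∈ supp μ} N_δ(X + fX) ≥
δ^{-ε} N_δ(X)`. -/
theorem growth_under_spread_out_measure (n : ℕ) (hn : 0 < n)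
    [MeasurableSpace (EuclideanSpace ℝ (Fin n) →L[ℝ] EuclideanSpace ℝ (Fin n))]
    [BorelSpace (EuclideanSpace ℝ (Fin n) →L[ℝ] EuclideanSpace ℝ (Fin n))]
    (κ : ℝ) (hκ : 0 < κ) (σ τ : ℝ) (hσ : 0 < σ) (hστ : σ < τ) :
    ∃ ε : ℝ, 0 < ε ∧ ∃ δ₀ : ℝ, 0 < δ₀ ∧ ∀ δ : ℝ, 0 < δ → δ < δ₀ →
      ∀ (X : Set (EuclideanSpace ℝ (Fin n)))
        (μ : Measure (EuclideanSpace ℝ (Fin n) →L[ℝ] EuclideanSpace ℝ (Fin n)))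
        [IsProbabilityMeasure μ],
        X ⊆ Metric.closedBall 0 (δ ^ (-ε)) →
        (∀ ρ : ℝ, δ ≤ ρ → δ ^ ε * ρ ^ (-κ) ≤ (covNum ρ X : ℝ)) →
        (covNum δ X : ℝ) ≤ δ ^ (-(σ + ε)) →
        msupport μ ⊆ Metric.closedBall 0 (δ ^ (-ε)) →
        (∀ ρ : ℝ, δ ≤ ρ → ∀ v w : EuclideanSpace ℝ (Fin n), ‖v‖ = 1 →
          μ {f | ‖f v - w‖ ≤ ρ} ≤ ENNReal.ofReal (δ ^ (-ε) * ρ ^ τ)) →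
        (δ ^ (-ε) / 2 * (covNum δ X : ℝ) ≤ (covNum δ (X + X) : ℝ) ∨
          ∃ f ∈ msupport μ, δ ^ (-ε) / 2 * (covNum δ X : ℝ) ≤
            (covNum δ (X + (fun x => f x) '' X) : ℝ)) := by
  classical
  obtain ⟨C₀, hC₀⟩ := exists_covNum_le_mul_card (EuclideanSpace ℝ (Fin n))
  obtain ⟨C, hC, hcov⟩ : ∃ C : ℝ, 0 < C ∧ ∀ δ : ℝ, 0 < δ →
      ∀ (S : Set (EuclideanSpace ℝ (Fin n))) (P : Finset (EuclideanSpace ℝ (Fin n))),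
      S ⊆ ⋃ x ∈ P, closedBall x (4 * δ) → (covNum δ S : ℝ) ≤ C * P.card := by
    refine ⟨C₀ + 1, by positivity, fun δ hδ S P hS => ?_⟩
    have : (covNum δ S : ℝ) ≤ C₀ * P.card := by exact_mod_cast hC₀ δ hδ S P hS
    have : (0 : ℝ) ≤ P.card := by positivity
    linarith
  have hτ : 0 < τ := hσ.trans hστ
  have hκτ : 0 < κ + τ := by positivity
  -- the exponent of the intermediate scale `r = δ ^ a`
  obtain ⟨a, ha₀, ha₁, ε, hε, haε, hετ⟩ : ∃ a : ℝ, 0 < a ∧ a ≤ 1 ∧ ∃ ε : ℝ, 0 < ε ∧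
      a * κ = 4 * ε ∧ 4 * ε + a * τ = τ - σ := by
    refine ⟨(τ - σ) / (κ + τ), div_pos (by linarith) hκτ, ?_,
      (τ - σ) / (κ + τ) * κ / 4, ?_, by ring, ?_⟩
    · rw [div_le_one hκτ]
      linarith
    · have : 0 < (τ - σ) / (κ + τ) := div_pos (by linarith) hκτ
      positivity
    · field_simp
  set η : ℝ := min (2 / (C ^ 2 * 4 ^ κ)) (1 / (C * 2 ^ τ)) with hη
  have hη₀ : 0 < η := by positivity
  refine ⟨ε, hε, min 1 (η ^ ε⁻¹), by positivity, ?_⟩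
  intro δ hδ hδ₀ X μ _ hXB hXκ hXσ _ hμ
  have hδ₁ : δ < 1 := hδ₀.trans_le (min_le_left _ _)
  have hδε : δ ^ ε < η :=
    (Real.lt_rpow_inv_iff_of_pos hδ.le hη₀.le hε).1 (hδ₀.trans_le (min_le_right _ _))
  by_contra! hcon
  obtain ⟨hadd, hgrow⟩ := hcon
  have hX : Bornology.IsBounded X := isBounded_closedBall.subset hXB
  set r : ℝ := δ ^ a with hr
  have hr₀ : 0 < r := by positivity
  have hδr : δ ≤ r := by
    simpa using Real.rpow_le_rpow_of_exponent_ge hδ hδ₁.le ha₁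
  have hr₁ : r ≤ 1 := Real.rpow_le_one hδ.le hδ₁.le ha₀.le
  obtain ⟨P, hPX, hP, hXP⟩ := exists_separated_net (δ := 2 * δ) (by positivity) hX
  have hNP : (covNum δ X : ℝ) ≤ C * P.card := hcov δ hδ X P (by
    rwa [← mul_assoc, show (2 : ℝ) * 2 = 4 by norm_num] at hXP)
  have hPN : (P.card : ℝ) ≤ covNum δ X := by
    exact_mod_cast card_le_covNum hδ hX hPX fun x hx y hy h => hP x hx y hy (by linarith)
  set p : ℝ := (P.card : ℝ) with hp
  have hp₀ : 0 < p := by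
    have h : 0 < (covNum δ X : ℝ) := lt_of_lt_of_le (by positivity) (hXκ δ le_rfl)
    exact pos_of_mul_pos_right (h.trans_le hNP) hC.le
  set t : ℝ := δ ^ ε with ht
  have ht₀ : 0 < t := by positivity
  have hneg : δ ^ (-ε) = t⁻¹ := Real.rpow_neg hδ.le ε
  rw [hneg] at hadd hgrow
  have hM : t⁻¹ / 2 * (covNum δ X : ℝ) ≤ t⁻¹ / 2 * (C * p) := by gcongr
  -- few points of `P` in each ball of radius `r`
  have hrκ : (4 * r) ^ (-κ) = (4 ^ κ)⁻¹ * (t ^ 4)⁻¹ := by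
    rw [Real.mul_rpow (by norm_num) hr₀.le, Real.rpow_neg (by norm_num), Real.rpow_neg hr₀.le,
      hr, ← Real.rpow_mul hδ.le, haε, ht, ← Real.rpow_mul_natCast hδ.le]
    norm_num [mul_comm]
  have hball : ∀ y ∈ P, ((P.filter fun y' => dist y y' ≤ r).card : ℝ) ≤
      4 ^ κ * C * t ^ 2 * p / 2 := by
    intro y _
    set b : ℝ := ((P.filter fun y' => dist y y' ≤ r).card : ℝ) with hb
    have hb₀ : 0 ≤ b := by positivity
    have h₁ : (covNum (4 * r) X : ℝ) * b ≤ covNum δ (X + X) := by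
      rw [hb]
      exact_mod_cast covNum_mul_card_ball_le hδ hδr hX hPX hP y
    have h₂ := hXκ (4 * r) (by linarith)
    rw [hrκ] at h₂
    have h₃ : t * ((4 ^ κ)⁻¹ * (t ^ 4)⁻¹) * b ≤ t⁻¹ / 2 * (C * p) :=
      (mul_le_mul_of_nonneg_right h₂ hb₀).trans (h₁.trans (hadd.le.trans hM))
    have h₄ := mul_le_mul_of_nonneg_left h₃ (show 0 ≤ 4 ^ κ * t ^ 3 by positivity)
    calc b = 4 ^ κ * t ^ 3 * (t * ((4 ^ κ)⁻¹ * (t ^ 4)⁻¹) * b) := by field_simp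
      _ ≤ _ := h₄
      _ = _ := by field_simp
  set Q := ((P ×ˢ P) ×ˢ (P ×ˢ P)).filter fun q => ¬ dist q.1.2 q.2.2 ≤ r with hQ
  let A : (EuclideanSpace ℝ (Fin n) × EuclideanSpace ℝ (Fin n)) ×
      (EuclideanSpace ℝ (Fin n) × EuclideanSpace ℝ (Fin n)) →
      Set (EuclideanSpace ℝ (Fin n) →L[ℝ] EuclideanSpace ℝ (Fin n)) :=
    fun q => {f | ‖f (q.1.2 - q.2.2) - (q.2.1 - q.1.1)‖ ≤ 2 * δ}
  have hA : ∀ q ∈ Q, MeasurableSet (A q) := fun q _ =>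
    (isClosed_le (by fun_prop) continuous_const).measurableSet
  -- most collisions come from distant pairs
  have hfar : ∀ f ∈ msupport μ, p ^ 3 * t / C ≤ ((Q.filter fun q => f ∈ A q).card : ℝ) := by
    intro f hf
    have h₆ : t * (C ^ 2 * 4 ^ κ) ≤ 2 :=
      (le_div_iff₀ (by positivity)).1 (hδε.le.trans (min_le_left _ _))
    have h := le_card_far_collisions hδ hX hPX hP hp₀ f hC ht₀ (by positivity)
      ((hgrow f hf).le.trans hM) hball h₆
    rwa [hQ, Finset.filter_filter, Finset.filter_congr fun q _ => and_comm]
  have hsum := le_sum_measureReal_of_le_card μ Q A hA _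
    ((msupport_mem_ae μ).mono hfar)
  -- each distant collision is rare
  have hρ : δ ≤ 2 * δ / r := by
    rw [le_div_iff₀ hr₀]
    linarith [mul_le_mul_of_nonneg_left hr₁ hδ.le]
  have hrare : ∀ q ∈ Q, μ.real (A q) ≤ t⁻¹ * (2 * δ / r) ^ τ := by
    intro q hq
    refine measureReal_norm_sub_le μ (by positivity) (by positivity) hr₀
      (fun v w hv => hneg ▸ hμ _ hρ v w hv) _ _ ?_
    rw [← dist_eq_norm]
    exact (not_le.1 (Finset.mem_filter.1 hq).2).le
  have hQcard : (Q.card : ℝ) ≤ p ^ 4 := by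
    have h : Q.card ≤ P.card ^ 4 := by
      refine (Finset.card_filter_le _ _).trans (le_of_eq ?_)
      rw [Finset.card_product, Finset.card_product]
      ring
    rw [hp]
    exact_mod_cast h
  have hfin : p ^ 3 * t / C ≤ p ^ 4 * (t⁻¹ * (2 * δ / r) ^ τ) := by
    refine hsum.trans ((Finset.sum_le_card_nsmul _ _ _ hrare).trans ?_)
    rw [nsmul_eq_mul]
    gcongr
  have hpσ : p ≤ δ ^ (-(σ + ε)) := hPN.trans hXσ
  have hpow : δ ^ (-(σ + ε)) * (2 * δ / r) ^ τ = 2 ^ τ * t ^ 3 := by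
    have hdiv : δ / r = δ ^ (1 - a) := by rw [Real.rpow_sub hδ, Real.rpow_one]
    rw [mul_div_assoc, Real.mul_rpow (by norm_num) (by positivity), mul_left_comm, hdiv,
      ← Real.rpow_mul hδ.le, ← Real.rpow_add hδ, ht, ← Real.rpow_mul_natCast hδ.le]
    congr 2
    push_cast
    linarith
  have hlt : t * (C * 2 ^ τ) < 1 :=
    (lt_div_iff₀ (by positivity)).1 (hδε.trans_le (min_le_right _ _))
  exact hlt.not_ge (one_le_mul_of_pow_three_le hp₀ ht₀ hC (by positivity) hfin hpσ hpow)
end
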